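/- Let α ∈ (0,1) and let the temporal mesh be quasi-graded with parameter r ≥ 1 and constants c_0 ≤ C_0. Let u ∈ C([0,T]) ∩ C^3((0,T]) with ψ^1,...,ψ^M finite, and for m = 1,...,M define the truncation error r^m := δ_t^{α,*} u(t_m) − D_t^α u(t_m^*), where δ_t^{α,*} is applied to the sequence (u(t_0), u(t_1), ..., u(t_M)) and D_t^α is the Caputo derivative. Then there exists a constant C > 0, depending only on α, r, T, c_0, C_0, such that |r^m| ≤ C (τ_1/t_m)^{min{α+1, (3−α)/r}} · max_{j=1,...,m} ψ^j for all m = 1,...,M. -/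

import Mathlib

open Real MeasureTheory Set

/-- The L1 discrete fractional-derivative operator associated with the mesh `t`,
applied to the sequence `V`, at time level `m`. -/
noncomputable def deltaL1 (α : ℝ) (t : ℕ → ℝ) (V : ℕ → ℝ) (m : ℕ) : ℝ :=
  (1 / Real.Gamma (1 - α)) *
    ∑ j ∈ Finset.Icc 1 m,
      ((V j - V (j - 1)) / (t j - t (j - 1))) *
        ∫ s in (t (j - 1))..(t j), (t m - s) ^ (-α)

/-- `t 0 = 0 < t 1 < ... < t M = T` with `M ≥ 2`. -/
def IsMesh (T : ℝ) (M : ℕ) (t : ℕ → ℝ) : Prop :=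
  2 ≤ M ∧ t 0 = 0 ∧ (∀ j, j < M → t j < t (j + 1)) ∧ t M = T

/-- Quasi-graded mesh with parameter `r` and constants `c0 ≤ C0`. -/
def QuasiGraded (r c0 C0 : ℝ) (M : ℕ) (t : ℕ → ℝ) : Prop :=
  (c0 * (M : ℝ) ^ (-r) ≤ t 1 ∧ t 1 ≤ C0 * (M : ℝ) ^ (-r)) ∧
  (∀ j : ℕ, 1 ≤ j → j ≤ M →
    c0 * (t 1 * (j : ℝ) ^ r) ≤ t j ∧ t j ≤ C0 * (t 1 * (j : ℝ) ^ r)) ∧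
  (∀ j : ℕ, 1 ≤ j → j ≤ M →
    c0 * ((t 1) ^ (1 / r) * (t j) ^ (1 - 1 / r)) ≤ t j - t (j - 1) ∧
    t j - t (j - 1) ≤ C0 * ((t 1) ^ (1 / r) * (t j) ^ (1 - 1 / r)))

/-- The stability majorant `𝒱^j`. -/
noncomputable def Vcal (α γ τ tj : ℝ) : ℝ :=
  if 0 < γ then τ * tj ^ (α - 1)
  else if γ = 0 then τ * tj ^ (α - 1) * (1 + Real.log (tj / τ))
  else τ * tj ^ (α - 1) * (τ / tj) ^ γ

/-- The Caputo fractional derivative of order `α`. -/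
noncomputable def caputo (α : ℝ) (u : ℝ → ℝ) (t : ℝ) : ℝ :=
  (1 / Real.Gamma (1 - α)) * ∫ s in (0:ℝ)..t, (t - s) ^ (-α) * deriv u s

/-- Linear Lagrange interpolant with data `(a, ya)`, `(b, yb)`. -/
noncomputable def lagLin (a b ya yb s : ℝ) : ℝ := ya + (yb - ya) / (b - a) * (s - a)

/-- Quadratic Lagrange interpolant with data `(x0, y0)`, `(x1, y1)`, `(x2, y2)`. -/
noncomputable def lagQuad (x0 x1 x2 y0 y1 y2 s : ℝ) : ℝ :=
  y0 * ((s - x1) * (s - x2)) / ((x0 - x1) * (x0 - x2)) +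
  y1 * ((s - x0) * (s - x2)) / ((x1 - x0) * (x1 - x2)) +
  y2 * ((s - x0) * (s - x1)) / ((x2 - x0) * (x2 - x1))

/-- The Alikhanov collocation point `t_m^* = t_m - (α/2) τ_m`. -/
noncomputable def tStar (α : ℝ) (t : ℕ → ℝ) (m : ℕ) : ℝ :=
  t m - (α / 2) * (t m - t (m - 1))

/-- The Alikhanov discrete fractional-derivative operator `δ_t^{α,*}`:
`(1/Γ(1-α)) ∫_0^{t_m^*} (t_m^* - s)^{-α} (Π^m U)'(s) ds`, where `Π^m U` is the
quadratic Lagrange interpolant of `(t_{j-1},U^{j-1}), (t_j,U^j), (t_{j+1},U^{j+1})`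
on `(t_{j-1},t_j)` for `j < m`, and the linear interpolant of
`(t_{m-1},U^{m-1}), (t_m,U^m)` on `(t_{m-1}, t_m^*)`. -/
noncomputable def deltaAlik (α : ℝ) (t : ℕ → ℝ) (U : ℕ → ℝ) (m : ℕ) : ℝ :=
  (1 / Real.Gamma (1 - α)) *
    ((∑ j ∈ Finset.Icc 1 (m - 1),
        ∫ s in (t (j - 1))..(t j),
          (tStar α t m - s) ^ (-α) *
            deriv (fun x =>
              lagQuad (t (j - 1)) (t j) (t (j + 1)) (U (j - 1)) (U j) (U (j + 1)) x) s) +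
      ∫ s in (t (m - 1))..(tStar α t m),
        (tStar α t m - s) ^ (-α) * ((U m - U (m - 1)) / (t m - t (m - 1))))

/-- The Alikhanov mesh condition ensuring the discrete maximum principle:
with `ρ_j = τ_{j+1}/τ_j`, either `0.4656 ≤ ρ_j ≤ ρ_{j-1}` for all `2 ≤ j ≤ M-1`,
or `ρ_j ≥ 4/7` for all `2 ≤ j ≤ M-1`. -/
def AlikhanovCond (M : ℕ) (t : ℕ → ℝ) : Prop :=
  (∀ j : ℕ, 2 ≤ j → j ≤ M - 1 →
      (0.4656 : ℝ) ≤ (t (j + 1) - t j) / (t j - t (j - 1)) ∧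
      (t (j + 1) - t j) / (t j - t (j - 1)) ≤
        (t j - t (j - 1)) / (t (j - 1) - t (j - 2))) ∨
  (∀ j : ℕ, 2 ≤ j → j ≤ M - 1 →
      (4 / 7 : ℝ) ≤ (t (j + 1) - t j) / (t j - t (j - 1)))

/-- The quantities `ψ^j` of (4.7) for the Alikhanov scheme:
`ψ^1 = sup_{s∈(0,t_2)} s^{1-α}|u'(s)| + t_2^{-α} osc(u,[0,t_2])`,
`ψ^j = t_j^{3-α} sup_{s∈(t_{j-1},t_{j+1})} |u'''(s)|` for `2 ≤ j ≤ M-1`, and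
`ψ^M = ψ^{M-1}`. -/
noncomputable def psiAlik (α : ℝ) (M : ℕ) (t : ℕ → ℝ) (u : ℝ → ℝ) (j : ℕ) : ℝ :=
  if j = 1 then
    sSup ((fun s => s ^ (1 - α) * |deriv u s|) '' Set.Ioo 0 (t 2)) +
      (t 2) ^ (-α) * (sSup (u '' Set.Icc 0 (t 2)) - sInf (u '' Set.Icc 0 (t 2)))
  else if j = M then
    (t (M - 1)) ^ (3 - α) *
      sSup ((fun s => |deriv (deriv (deriv u)) s|) '' Set.Ioo (t (M - 2)) (t M))
  else
    (t j) ^ (3 - α) *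
      sSup ((fun s => |deriv (deriv (deriv u)) s|) '' Set.Ioo (t (j - 1)) (t (j + 1)))

theorem abs_sub_le_of_abs_deriv_le {f f' : ℝ → ℝ} {a b K : ℝ} (hc : ContinuousOn f (Icc a b))
    (hd : ∀ x ∈ Ioo a b, HasDerivAt f (f' x) x) (hb : ∀ x ∈ Ioo a b, |f' x| ≤ K)
    {x y : ℝ} (hx : x ∈ Icc a b) (hy : y ∈ Icc a b) : |f x - f y| ≤ K * |x - y| := by
  have key : ∀ x ∈ Icc a b, ∀ y ∈ Icc a b, x < y → |f x - f y| ≤ K * |x - y| := by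
    intro x hx y hy hxy
    obtain ⟨c, hcm, hce⟩ := exists_hasDerivAt_eq_slope f f' hxy
      (hc.mono (Icc_subset_Icc hx.1 hy.2))
      (fun z hz => hd z ⟨hx.1.trans_lt hz.1, hz.2.trans_le hy.2⟩)
    have h1 := hb c ⟨hx.1.trans_lt hcm.1, hcm.2.trans_le hy.2⟩
    rw [hce, abs_div, div_le_iff₀ (abs_pos.2 (sub_pos.2 hxy).ne')] at h1
    rwa [abs_sub_comm (f x), abs_sub_comm x]
  rcases lt_trichotomy x y with h | h | h
  · exact key x hx y hy h
  · simp [h]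
  · rw [abs_sub_comm (f x), abs_sub_comm x]
    exact key y hy x hx h

theorem exists_quadratic_approx {u : ℝ → ℝ} {a b c K : ℝ} (hcont : ContinuousOn u (Icc a b))
    (h0 : ∀ x ∈ Ioo a b, DifferentiableAt ℝ u x)
    (h1 : ∀ x ∈ Ioo a b, DifferentiableAt ℝ (deriv u) x)
    (h2 : ∀ x ∈ Ioo a b, DifferentiableAt ℝ (deriv (deriv u)) x)
    (hK : ∀ x ∈ Ioo a b, |deriv (deriv (deriv u)) x| ≤ K) (hc : c ∈ Ioo a b) :
    ∃ A B E : ℝ,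
      (∀ s ∈ Ioo a b, |deriv u s - (B + 2 * E * (s - c))| ≤ K * (b - a) ^ 2) ∧
      ∀ s ∈ Icc a b, |u s - (A + B * (s - c) + E * (s - c) ^ 2)| ≤ K * (b - a) ^ 3 := by
  have hK0 : 0 ≤ K := (abs_nonneg _).trans (hK c hc)
  have hab : a < b := hc.1.trans hc.2
  have hdist : ∀ s ∈ Icc a b, |s - c| ≤ b - a := fun s hs => by
    rw [abs_le]; constructor <;> linarith [hs.1, hs.2, hc.1, hc.2]
  have e2 : ∀ s ∈ Ioo a b, |deriv (deriv u) s - deriv (deriv u) c| ≤ K * (b - a) := by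
    intro s hs
    have := (convex_Ioo a b).norm_image_sub_le_of_norm_deriv_le (f := deriv (deriv u)) h2 hK hc hs
    exact this.trans (mul_le_mul_of_nonneg_left (hdist s (Ioo_subset_Icc_self hs)) hK0)
  set E := deriv (deriv u) c / 2 with hE
  set B := deriv u c with hB
  have d1 : ∀ x ∈ Ioo a b, HasDerivAt (fun s => deriv u s - (B + 2 * E * (s - c)))
      (deriv (deriv u) x - deriv (deriv u) c) x := by
    intro x hx
    have := (h1 x hx).hasDerivAt.sub ((((hasDerivAt_id x).sub_const c).const_mul (2 * E)).const_add B)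
    exact this.congr_deriv (by rw [hE]; ring)
  have e1 : ∀ s ∈ Ioo a b, |deriv u s - (B + 2 * E * (s - c))| ≤ K * (b - a) ^ 2 := by
    intro s hs
    have := (convex_Ioo a b).norm_image_sub_le_of_norm_hasDerivWithin_le
      (fun x hx => (d1 x hx).hasDerivWithinAt) e2 hc hs
    simp only [sub_self, mul_zero, add_zero, hB, sub_zero, Real.norm_eq_abs] at this
    refine this.trans ?_
    calc K * (b - a) * |s - c| ≤ K * (b - a) * (b - a) := by
          have := hdist s (Ioo_subset_Icc_self hs)
          have : 0 ≤ K * (b - a) := mul_nonneg hK0 (by linarith)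
          gcongr
      _ = _ := by ring
  refine ⟨u c, B, E, e1, fun s hs => ?_⟩
  have d0 : ∀ x ∈ Ioo a b, HasDerivAt (fun s => u s - (u c + B * (s - c) + E * (s - c) ^ 2))
      (deriv u x - (B + 2 * E * (x - c))) x := by
    intro x hx
    have hi := (hasDerivAt_id x).sub_const c
    have := (h0 x hx).hasDerivAt.sub (((hi.const_mul B).const_add (u c)).add
      ((hi.pow 2).const_mul E))
    exact this.congr_deriv (by simp; ring)
  have := abs_sub_le_of_abs_deriv_le (f := fun s => u s - (u c + B * (s - c) + E * (s - c) ^ 2))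
    (hcont.sub (by fun_prop)) d0 e1 hs (Ioo_subset_Icc_self hc)
  simp only [sub_self, mul_zero, add_zero, sub_zero, ne_eq, OfNat.ofNat_ne_zero,
    not_false_eq_true, zero_pow] at this
  refine this.trans ?_
  calc K * (b - a) ^ 2 * |s - c| ≤ K * (b - a) ^ 2 * (b - a) := by
        have := hdist s hs
        gcongr
    _ = _ := by ring

theorem abs_lagQuad_le {x0 x1 x2 y0 y1 y2 s Λ Y : ℝ} (h01 : x0 < x1) (h12 : x1 < x2)
    (hs : s ∈ Icc x0 x1) (hΛ : x2 - x0 ≤ Λ * (x2 - x1))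
    (hy0 : |y0| ≤ Y) (hy1 : |y1| ≤ Y) (hy2 : |y2| ≤ Y) :
    |lagQuad x0 x1 x2 y0 y1 y2 s| ≤ (1 + 2 * Λ) * Y := by
  obtain ⟨hs0, hs1⟩ := hs
  have p01 := sub_pos.2 h01
  have p12 := sub_pos.2 h12
  have p02 := sub_pos.2 (h01.trans h12)
  have b0 : |(s - x1) * (s - x2) / ((x0 - x1) * (x0 - x2))| ≤ 1 := by
    have e : (s - x1) * (s - x2) / ((x0 - x1) * (x0 - x2)) =
      (x1 - s) * (x2 - s) / ((x1 - x0) * (x2 - x0)) := by congr 1 <;> ring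
    have : 0 ≤ (x1 - s) * (x2 - s) := mul_nonneg (by linarith) (by linarith)
    rw [e, abs_of_nonneg (by positivity), div_le_one (by positivity)]
    exact mul_le_mul (by linarith) (by linarith) (by linarith) p01.le
  have b1 : |(s - x0) * (s - x2) / ((x1 - x0) * (x1 - x2))| ≤ Λ := by
    have e : (s - x0) * (s - x2) / ((x1 - x0) * (x1 - x2)) =
      (s - x0) * (x2 - s) / ((x1 - x0) * (x2 - x1)) := by
      rw [← neg_div_neg_eq]; congr 1 <;> ring
    have : 0 ≤ (s - x0) * (x2 - s) := mul_nonneg (by linarith) (by linarith)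
    rw [e, abs_of_nonneg (by positivity), div_le_iff₀ (by positivity)]
    calc (s - x0) * (x2 - s) ≤ (x1 - x0) * (Λ * (x2 - x1)) :=
          mul_le_mul (by linarith) (by linarith) (by linarith) p01.le
      _ = _ := by ring
  have b2 : |(s - x0) * (s - x1) / ((x2 - x0) * (x2 - x1))| ≤ Λ := by
    have e : |(s - x0) * (s - x1) / ((x2 - x0) * (x2 - x1))| =
      (s - x0) * (x1 - s) / ((x2 - x0) * (x2 - x1)) := by
      rw [abs_div, abs_mul, abs_of_nonneg (by linarith : 0 ≤ s - x0),
        abs_of_nonpos (by linarith : s - x1 ≤ 0), abs_of_pos (by positivity)]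
      congr 1; ring
    rw [e, div_le_iff₀ (by positivity)]
    calc (s - x0) * (x1 - s) ≤ (x2 - x0) * (Λ * (x2 - x1)) :=
          mul_le_mul (by linarith) (by linarith) (by linarith) p02.le
      _ = _ := by ring
  have hY : 0 ≤ Y := (abs_nonneg _).trans hy0
  unfold lagQuad
  rw [mul_div_assoc y0, mul_div_assoc y1, mul_div_assoc y2]
  refine (abs_add_three _ _ _).trans ?_
  rw [abs_mul y0, abs_mul y1, abs_mul y2]
  have i0 := mul_le_mul hy0 b0 (abs_nonneg _) hY
  have i1 := mul_le_mul hy1 b1 (abs_nonneg _) hY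
  have i2 := mul_le_mul hy2 b2 (abs_nonneg _) hY
  linarith

theorem lagQuad_sub_quadratic {x0 x1 x2 : ℝ} (h01 : x0 ≠ x1) (h12 : x1 ≠ x2) (h02 : x0 ≠ x2)
    (y0 y1 y2 A B E c s : ℝ) :
    lagQuad x0 x1 x2 (y0 - (A + B * (x0 - c) + E * (x0 - c) ^ 2))
      (y1 - (A + B * (x1 - c) + E * (x1 - c) ^ 2))
      (y2 - (A + B * (x2 - c) + E * (x2 - c) ^ 2)) s =
    lagQuad x0 x1 x2 y0 y1 y2 s - (A + B * (s - c) + E * (s - c) ^ 2) := by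
  have := sub_ne_zero.2 h01
  have := sub_ne_zero.2 h12
  have := sub_ne_zero.2 h02
  have := sub_ne_zero.2 h01.symm
  have := sub_ne_zero.2 h12.symm
  have := sub_ne_zero.2 h02.symm
  unfold lagQuad
  rw [← neg_sub x1 x0, ← neg_sub x2 x0, ← neg_sub x2 x1]
  field_simp
  ring

theorem abs_lagQuad_sub_le {u : ℝ → ℝ} {x0 x1 x2 s Λ Y A B E c : ℝ} (h01 : x0 < x1) (h12 : x1 < x2)
    (hs : s ∈ Icc x0 x1) (hΛ : x2 - x0 ≤ Λ * (x2 - x1))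
    (hY : ∀ x ∈ Icc x0 x2, |u x - (A + B * (x - c) + E * (x - c) ^ 2)| ≤ Y) :
    |lagQuad x0 x1 x2 (u x0) (u x1) (u x2) s - u s| ≤ (2 + 2 * Λ) * Y := by
  have h02 := h01.trans h12
  have e := lagQuad_sub_quadratic h01.ne h12.ne h02.ne (u x0) (u x1) (u x2) A B E c s
  have b := abs_lagQuad_le h01 h12 hs hΛ (hY x0 ⟨le_rfl, h02.le⟩) (hY x1 ⟨h01.le, h12.le⟩)
    (hY x2 ⟨h02.le, le_rfl⟩)
  rw [e] at b
  have b' := hY s ⟨hs.1, hs.2.trans h12.le⟩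
  rw [abs_le] at *
  constructor <;> linarith [b.1, b.2, b'.1, b'.2]

theorem lagQuad_left {x0 x1 x2 : ℝ} (h01 : x0 ≠ x1) (h02 : x0 ≠ x2) (y0 y1 y2 : ℝ) :
    lagQuad x0 x1 x2 y0 y1 y2 x0 = y0 := by
  have := sub_ne_zero.2 h01
  have := sub_ne_zero.2 h02
  unfold lagQuad
  field_simp
  simp

theorem lagQuad_mid {x0 x1 x2 : ℝ} (h01 : x0 ≠ x1) (h12 : x1 ≠ x2) (y0 y1 y2 : ℝ) :
    lagQuad x0 x1 x2 y0 y1 y2 x1 = y1 := by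
  have := sub_ne_zero.2 h01.symm
  have := sub_ne_zero.2 h12
  unfold lagQuad
  field_simp
  simp

theorem contDiff_lagQuad (x0 x1 x2 y0 y1 y2 : ℝ) :
    ContDiff ℝ 1 (lagQuad x0 x1 x2 y0 y1 y2) := by
  unfold lagQuad
  fun_prop

theorem continuousOn_sub_rpow {a b p : ℝ} (hbp : b < p) (q : ℝ) :
    ContinuousOn (fun s => (p - s) ^ q) (Icc a b) :=
  (continuousOn_const.sub continuousOn_id).rpow_const
    fun _ hx => Or.inl (sub_pos.2 (hx.2.trans_lt hbp)).ne'

theorem intervalIntegrable_sub_rpow {a b p : ℝ} (hab : a ≤ b) (hbp : b < p) (q : ℝ) :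
    IntervalIntegrable (fun s => (p - s) ^ q) volume a b :=
  (continuousOn_sub_rpow hbp q).intervalIntegrable_of_Icc hab

theorem intervalIntegrable_sub_rpow_neg {α : ℝ} (hα1 : α < 1) (a p : ℝ) :
    IntervalIntegrable (fun s => (p - s) ^ (-α)) volume a p := by
  have h : IntervalIntegrable (fun x : ℝ => x ^ (-α)) volume (p - a) 0 :=
    intervalIntegral.intervalIntegrable_rpow' (by linarith)
  simpa using h.comp_sub_left p

theorem integral_sub_rpow_neg {α : ℝ} (hα1 : α < 1) (a p : ℝ) :
    ∫ s in a..p, (p - s) ^ (-α) = (p - a) ^ (1 - α) / (1 - α) := by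
  rw [intervalIntegral.integral_comp_sub_left (fun x => x ^ (-α)) p,
    integral_rpow (Or.inl (by linarith))]
  rw [sub_self, zero_rpow (by linarith), neg_add_eq_sub, sub_zero]

theorem integral_sub_rpow_neg_sub_one_le {α a b p : ℝ} (hα0 : 0 < α) (hab : a ≤ b) (hbp : b < p) :
    ∫ s in a..b, (p - s) ^ (-α - 1) ≤ (p - b) ^ (-α) / α := by
  rw [intervalIntegral.integral_comp_sub_left (fun x => x ^ (-α - 1)) p,
    integral_rpow (Or.inr ⟨by linarith, ?_⟩)]
  · rw [sub_add_cancel, ← neg_div_neg_eq, neg_neg]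
    have : 0 ≤ (p - a) ^ (-α) := rpow_nonneg (by linarith) _
    gcongr
    linarith
  · rw [uIcc_of_le (by linarith)]
    intro h
    linarith [h.1]

theorem abs_integral_weight_mul_deriv_le {α p a b F : ℝ} {f f' : ℝ → ℝ} (hα0 : 0 < α) (hab : a ≤ b)
    (hbp : b < p) (hc : ContinuousOn f (Icc a b)) (hd : ∀ x ∈ Ioo a b, HasDerivAt f (f' x) x)
    (hi : IntervalIntegrable f' volume a b) (ha : f a = 0) (hb : f b = 0)
    (hF : ∀ x ∈ Icc a b, |f x| ≤ F) :
    |∫ s in a..b, (p - s) ^ (-α) * f' s| ≤ ∫ s in a..b, α * F * (p - s) ^ (-α - 1) := by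
  have hw : ∀ x ∈ Ioo (min a b) (max a b),
      HasDerivAt (fun s => (p - s) ^ (-α)) (α * (p - x) ^ (-α - 1)) x := by
    intro x hx
    rw [min_eq_left hab, max_eq_right hab] at hx
    have := ((hasDerivAt_id x).const_sub p).rpow_const (p := -α)
      (Or.inl (sub_pos.2 (hx.2.trans hbp)).ne')
    exact this.congr_deriv (by simp)
  have hint := (intervalIntegrable_sub_rpow hab hbp (-α - 1)).const_mul α
  rw [intervalIntegral.integral_mul_deriv_eq_deriv_mul_of_hasDerivAt
    (by rw [uIcc_of_le hab]; exact continuousOn_sub_rpow hbp _)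
    (by rwa [uIcc_of_le hab]) hw (by rwa [min_eq_left hab, max_eq_right hab]) hint hi,
    ha, hb, mul_zero, mul_zero, sub_zero, zero_sub, abs_neg,
    ← Real.norm_eq_abs]
  refine intervalIntegral.norm_integral_le_of_norm_le hab (ae_of_all _ fun s hs => ?_)
    ((intervalIntegrable_sub_rpow hab hbp (-α - 1)).const_mul (α * F))
  have hp : 0 ≤ (p - s) ^ (-α - 1) := rpow_nonneg (by linarith [hs.2]) _
  rw [Real.norm_eq_abs, abs_mul, abs_mul, abs_of_pos hα0, abs_of_nonneg hp]
  calc α * (p - s) ^ (-α - 1) * |f s| ≤ α * (p - s) ^ (-α - 1) * F := by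
        gcongr
        exact hF s ⟨hs.1.le, hs.2⟩
    _ = _ := by ring

theorem weight_mul_rpow_le {α p s : ℝ} (hα0 : 0 < α) (hα1 : α < 1) (hs : 0 < s) (hsp : s ≤ p) :
    (p - s) ^ (-α) * s ^ (α - 1) ≤
      (p / 2) ^ (-α) * s ^ (α - 1) + (p / 2) ^ (α - 1) * (p - s) ^ (-α) := by
  have hp : 0 < p / 2 := by linarith
  have h1 : 0 ≤ (p - s) ^ (-α) := rpow_nonneg (by linarith) _
  have h2 : 0 ≤ s ^ (α - 1) := rpow_nonneg hs.le _
  have h3 : 0 ≤ (p / 2) ^ (-α) := rpow_nonneg hp.le _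
  have h4 : 0 ≤ (p / 2) ^ (α - 1) := rpow_nonneg hp.le _
  rcases le_total s (p / 2) with h | h
  · have : (p - s) ^ (-α) ≤ (p / 2) ^ (-α) :=
      rpow_le_rpow_of_nonpos hp (by linarith) (by linarith)
    nlinarith [mul_nonneg h4 h1, mul_le_mul_of_nonneg_right this h2]
  · have : s ^ (α - 1) ≤ (p / 2) ^ (α - 1) := rpow_le_rpow_of_nonpos hp h (by linarith)
    nlinarith [mul_nonneg h3 h2, mul_le_mul_of_nonneg_left this h1]

theorem intervalIntegrable_weight_majorant {α : ℝ} (hα0 : 0 < α) (hα1 : α < 1) (p : ℝ) :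
    IntervalIntegrable (fun s => (p / 2) ^ (-α) * s ^ (α - 1) + (p / 2) ^ (α - 1) * (p - s) ^ (-α))
      volume 0 p :=
  ((intervalIntegral.intervalIntegrable_rpow' (by linarith)).const_mul _).add
    ((intervalIntegrable_sub_rpow_neg hα1 0 p).const_mul _)

theorem integral_weight_majorant {α p : ℝ} (hα0 : 0 < α) (hα1 : α < 1) (hp : 0 < p) :
    ∫ s in (0 : ℝ)..p, ((p / 2) ^ (-α) * s ^ (α - 1) + (p / 2) ^ (α - 1) * (p - s) ^ (-α)) =
      2 ^ α / α + 2 ^ (1 - α) / (1 - α) := by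
  rw [intervalIntegral.integral_add
    ((intervalIntegral.intervalIntegrable_rpow' (by linarith)).const_mul _)
    ((intervalIntegrable_sub_rpow_neg hα1 0 p).const_mul _),
    intervalIntegral.integral_const_mul, intervalIntegral.integral_const_mul,
    integral_sub_rpow_neg hα1, integral_rpow (Or.inl (by linarith)), sub_add_cancel,
    zero_rpow hα0.ne', sub_zero, sub_zero, div_rpow hp.le zero_le_two, div_rpow hp.le zero_le_two,
    rpow_neg hp.le, rpow_neg zero_le_two, show α - 1 = -(1 - α) by ring, rpow_neg hp.le,
    rpow_neg zero_le_two]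
  have := rpow_pos_of_pos hp α
  have := rpow_pos_of_pos hp (1 - α)
  have : 0 < 1 - α := by linarith
  field_simp

theorem integral_graded_kernel_le {α γ β : ℝ} (hα0 : 0 < α) (hβγ : β ≤ γ)
    (hβα : β ≤ α + 1) (hne : β = α + 1 → β < γ) :
    ∃ C : ℝ, 0 < C ∧ ∀ τ x : ℝ, 0 < τ → τ ≤ x →
      ∫ s in τ..x, s ^ α * (τ / s) ^ γ ≤ C * (x ^ (α + 1) * (τ / x) ^ β) := by
  have key : ∀ q τ x : ℝ, q ≠ α + 1 → 0 < τ → τ ≤ x → ∫ s in τ..x, s ^ α * (τ / s) ^ q =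
      τ ^ q * ((x ^ (α + 1 - q) - τ ^ (α + 1 - q)) / (α + 1 - q)) := by
    intro q τ x hq hτ hx
    have hmem : (0 : ℝ) ∉ uIcc τ x := by
      rw [uIcc_of_le hx]; intro h; linarith [h.1]
    have e : ∫ s in τ..x, s ^ α * (τ / s) ^ q = ∫ s in τ..x, τ ^ q * s ^ (α - q) := by
      refine intervalIntegral.integral_congr fun s hs => ?_
      rw [uIcc_of_le hx] at hs
      have hs0 : 0 < s := hτ.trans_le hs.1
      rw [div_rpow hτ.le hs0.le, rpow_sub hs0]
      ring
    rw [e, intervalIntegral.integral_const_mul, integral_rpow (Or.inr ⟨?_, hmem⟩)]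
    · rw [show α - q + 1 = α + 1 - q by ring]
    · intro h; apply hq; linarith
  rcases eq_or_lt_of_le hβα with h | h
  · have hγ := hne h
    have hpos : 0 < γ - (α + 1) := by linarith
    refine ⟨1 / (γ - (α + 1)), by positivity, fun τ x hτ hx => ?_⟩
    have hx0 := hτ.trans_le hx
    rw [key γ τ x (by linarith) hτ hx, h, ← mul_rpow hx0.le (by positivity),
      mul_div_cancel₀ _ hx0.ne', ← neg_div_neg_eq, neg_sub, neg_sub, mul_div_assoc', div_mul_eq_mul_div,
      one_mul]
    gcongr
    rw [mul_sub, ← rpow_add hτ, add_sub_cancel]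
    have : 0 ≤ τ ^ γ * x ^ (α + 1 - γ) := by positivity
    linarith
  · have hpos : 0 < α + 1 - β := by linarith
    refine ⟨1 / (α + 1 - β), by positivity, fun τ x hτ hx => ?_⟩
    have hx0 := hτ.trans_le hx
    have hcont : ∀ q : ℝ, IntervalIntegrable (fun s => s ^ α * (τ / s) ^ q) volume τ x := by
      intro q
      apply ContinuousOn.intervalIntegrable_of_Icc hx
      refine (continuousOn_id.rpow_const fun s _ => Or.inr hα0.le).mul ?_
      exact (continuousOn_const.div continuousOn_id fun s hs => (hτ.trans_le hs.1).ne').rpow_const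
        fun s hs => Or.inl (div_pos hτ (hτ.trans_le hs.1)).ne'
    calc ∫ s in τ..x, s ^ α * (τ / s) ^ γ ≤ ∫ s in τ..x, s ^ α * (τ / s) ^ β := by
          refine intervalIntegral.integral_mono_on hx (hcont _) (hcont _) fun s hs => ?_
          have hs0 := hτ.trans_le hs.1
          have := rpow_le_rpow_of_exponent_ge (div_pos hτ hs0) ((div_le_one hs0).2 hs.1) hβγ
          gcongr
      _ ≤ _ := by
          rw [key β τ x h.ne hτ hx, div_rpow hτ.le hx0.le, mul_div_assoc', div_mul_eq_mul_div,
            one_mul]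
          refine div_le_div_of_nonneg_right ?_ hpos.le
          rw [rpow_sub hx0]
          have : 0 ≤ τ ^ β * τ ^ (α + 1 - β) := by positivity
          calc _ ≤ τ ^ β * (x ^ (α + 1) / x ^ β) := by linarith
            _ = _ := by ring

theorem abs_integral_lagQuad_error_le {α p x0 x1 x2 Λ Y A B E c : ℝ} {u : ℝ → ℝ} (hα0 : 0 < α)
    (h01 : x0 < x1) (h12 : x1 < x2) (hΛ : x2 - x0 ≤ Λ * (x2 - x1)) (hp : x1 < p)
    (hc : ContinuousOn u (Icc x0 x1)) (hd : ∀ x ∈ Ioo x0 x1, DifferentiableAt ℝ u x)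
    (hi : IntervalIntegrable (deriv u) volume x0 x1)
    (hY : ∀ x ∈ Icc x0 x2, |u x - (A + B * (x - c) + E * (x - c) ^ 2)| ≤ Y) :
    |∫ s in x0..x1, (p - s) ^ (-α) *
        (deriv (fun x => lagQuad x0 x1 x2 (u x0) (u x1) (u x2) x) s - deriv u s)| ≤
      ∫ s in x0..x1, α * ((2 + 2 * Λ) * Y) * (p - s) ^ (-α - 1) := by
  have hL := contDiff_lagQuad x0 x1 x2 (u x0) (u x1) (u x2)
  refine abs_integral_weight_mul_deriv_le
    (f := fun s => lagQuad x0 x1 x2 (u x0) (u x1) (u x2) s - u s) hα0 h01.le hp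
    (hL.continuous.continuousOn.sub hc)
    (fun x hx => ((hL.differentiable one_ne_zero) x).hasDerivAt.sub (hd x hx).hasDerivAt)
    (((hL.continuous_deriv le_rfl).intervalIntegrable _ _).sub hi) ?_ ?_
    (fun s hs => abs_lagQuad_sub_le h01 h12 hs hΛ hY)
  · rw [lagQuad_left h01.ne (h01.trans h12).ne, sub_self]
  · rw [lagQuad_mid h01.ne h12.ne, sub_self]

theorem integral_weight_mul_sub_midpoint {α a b : ℝ} (hα0 : 0 < α) (hα1 : α < 1) (hab : a < b) :
    ∫ s in a..(b - α / 2 * (b - a)),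
      (b - α / 2 * (b - a) - s) ^ (-α) * (s - (a + b) / 2) = 0 := by
  set p := b - α / 2 * (b - a) with hp
  have hap : a < p := by rw [hp]; nlinarith
  have e : ∫ s in a..p, (p - s) ^ (-α) * (s - (a + b) / 2) =
      ∫ s in a..p, ((p - (a + b) / 2) * (p - s) ^ (-α) - (p - s) ^ (1 - α)) := by
    refine intervalIntegral.integral_congr fun s hs => ?_
    rw [uIcc_of_le hap.le] at hs
    have : (p - s) ^ (1 - α) = (p - s) * (p - s) ^ (-α) := by
      rcases eq_or_lt_of_le (sub_nonneg.2 hs.2) with h | h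
      · rw [← h, zero_mul, zero_rpow (by linarith)]
      · rw [sub_eq_add_neg 1 α, rpow_add h, rpow_one]
    rw [this]
    ring
  have e1 : ∫ s in a..p, (p - s) ^ (1 - α) = (p - a) ^ (1 - α) * (p - a) / (2 - α) := by
    have := integral_sub_rpow_neg (α := α - 1) (by linarith) a p
    rw [neg_sub, show 1 - (α - 1) = 1 - α + 1 by ring, rpow_add (sub_pos.2 hap), rpow_one] at this
    rw [this, show 1 - α + 1 = 2 - α by ring]
  have i1 : IntervalIntegrable (fun s => (p - s) ^ (1 - α)) volume a p := by
    simpa using intervalIntegrable_sub_rpow_neg (α := α - 1) (by linarith) a p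
  rw [e, intervalIntegral.integral_sub ((intervalIntegrable_sub_rpow_neg hα1 a p).const_mul _) i1,
    intervalIntegral.integral_const_mul, integral_sub_rpow_neg hα1, e1]
  have h1 : 1 - α ≠ 0 := by linarith
  have h2 : 2 - α ≠ 0 := by linarith
  have e2 : p - (a + b) / 2 = (1 - α) / 2 * (b - a) := by rw [hp]; ring
  have e3 : p - a = (2 - α) / 2 * (b - a) := by rw [hp]; ring
  rw [e2, e3]
  field_simp
  ring

theorem abs_integral_linear_error_le {α a b K : ℝ} {u : ℝ → ℝ} (hα0 : 0 < α) (hα1 : α < 1)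
    (hab : a < b) (hcont : ContinuousOn u (Icc a b))
    (hcd : ContinuousOn (deriv u) (Icc a (b - α / 2 * (b - a))))
    (h0 : ∀ x ∈ Ioo a b, DifferentiableAt ℝ u x)
    (h1 : ∀ x ∈ Ioo a b, DifferentiableAt ℝ (deriv u) x)
    (h2 : ∀ x ∈ Ioo a b, DifferentiableAt ℝ (deriv (deriv u)) x)
    (hK : ∀ x ∈ Ioo a b, |deriv (deriv (deriv u)) x| ≤ K) :
    |∫ s in a..(b - α / 2 * (b - a)),
        (b - α / 2 * (b - a) - s) ^ (-α) * ((u b - u a) / (b - a) - deriv u s)| ≤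
      2 / (1 - α) * (K * (b - a) ^ (3 - α)) := by
  have hmid : (a + b) / 2 ∈ Ioo a b := ⟨by linarith, by linarith⟩
  obtain ⟨A, B, E, hd, hv⟩ := exists_quadratic_approx hcont h0 h1 h2 hK hmid
  have horth := integral_weight_mul_sub_midpoint hα0 hα1 hab
  set p := b - α / 2 * (b - a) with hp
  have hba : 0 < b - a := sub_pos.2 hab
  have hap : a < p := by rw [hp]; nlinarith
  have hpb : p < b := by rw [hp]; nlinarith
  have hK0 : 0 ≤ K := (abs_nonneg _).trans (hK _ hmid)
  have hslope : |(u b - u a) / (b - a) - B| ≤ K * (b - a) ^ 2 := by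
    have d0 : ∀ x ∈ Ioo a b, HasDerivAt
        (fun s => u s - (A + B * (s - (a + b) / 2) + E * (s - (a + b) / 2) ^ 2))
        (deriv u x - (B + 2 * E * (x - (a + b) / 2))) x := by
      intro x hx
      have hi := (hasDerivAt_id x).sub_const ((a + b) / 2)
      have := (h0 x hx).hasDerivAt.sub (((hi.const_mul B).const_add A).add
        ((hi.pow 2).const_mul E))
      exact this.congr_deriv (by simp; ring)
    have := abs_sub_le_of_abs_deriv_le
      (f := fun s => u s - (A + B * (s - (a + b) / 2) + E * (s - (a + b) / 2) ^ 2))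
      (hcont.sub (by fun_prop)) d0 hd (right_mem_Icc.2 hab.le) (left_mem_Icc.2 hab.le)
    rw [div_sub' hba.ne', abs_div, abs_of_pos hba, div_le_iff₀ hba]
    rw [abs_of_pos hba] at this
    calc |u b - u a - (b - a) * B| = _ := by congr 1; ring
      _ ≤ _ := this
  have hw := intervalIntegrable_sub_rpow_neg hα1 a p
  have hcd' : ContinuousOn (deriv u) (uIcc a p) := by rwa [uIcc_of_le hap.le]
  have e : ∫ s in a..p, (p - s) ^ (-α) * ((u b - u a) / (b - a) - deriv u s) =
      ∫ s in a..p, (p - s) ^ (-α) *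
        (((u b - u a) / (b - a) - B) - (deriv u s - (B + 2 * E * (s - (a + b) / 2)))) := by
    have hsplit : ∫ s in a..p, (p - s) ^ (-α) * ((u b - u a) / (b - a) - deriv u s) =
        ∫ s in a..p, ((p - s) ^ (-α) *
        (((u b - u a) / (b - a) - B) - (deriv u s - (B + 2 * E * (s - (a + b) / 2)))) -
        2 * E * ((p - s) ^ (-α) * (s - (a + b) / 2))) := by
      congr 1; ext s; ring
    rw [hsplit, intervalIntegral.integral_sub, intervalIntegral.integral_const_mul, horth, mul_zero,
      sub_zero]
    · exact hw.mul_continuousOn (continuousOn_const.sub (hcd'.sub (by fun_prop)))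
    · exact (hw.mul_continuousOn (by fun_prop)).const_mul _
  rw [e, ← Real.norm_eq_abs]
  refine (intervalIntegral.norm_integral_le_of_norm_le hap.le (ae_of_all _ fun s hs => ?_)
    (hw.const_mul (2 * K * (b - a) ^ 2))).trans ?_
  · have hs' := hd s ⟨hs.1, hs.2.trans_lt hpb⟩
    have hpos : 0 ≤ (p - s) ^ (-α) := rpow_nonneg (by linarith [hs.2]) _
    rw [Real.norm_eq_abs, abs_mul, abs_of_nonneg hpos, mul_comm]
    gcongr
    refine (abs_sub _ _).trans ?_
    linarith
  · rw [intervalIntegral.integral_const_mul, integral_sub_rpow_neg hα1]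
    have : (p - a) ^ (1 - α) ≤ (b - a) ^ (1 - α) :=
      rpow_le_rpow (by linarith) (by linarith) (by linarith)
    have h1α : 0 < 1 - α := by linarith
    calc _ ≤ 2 * K * (b - a) ^ 2 * ((b - a) ^ (1 - α) / (1 - α)) := by gcongr
      _ = _ := by
        rw [show 3 - α = 2 + (1 - α) by ring, rpow_add hba, rpow_two]
        ring

theorem abs_integral_const_sub_le {α a p G : ℝ} {g : ℝ → ℝ} (hα1 : α < 1) (hap : a ≤ p)
    (hg : ∀ s ∈ Ioo a p, |g s| ≤ G) :
    |∫ s in a..p, (p - s) ^ (-α) * g s| ≤ G * ((p - a) ^ (1 - α) / (1 - α)) := by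
  rw [← Real.norm_eq_abs, ← integral_sub_rpow_neg hα1, ← intervalIntegral.integral_const_mul]
  refine intervalIntegral.norm_integral_le_of_norm_le hap ?_
    ((intervalIntegrable_sub_rpow_neg hα1 a p).const_mul G)
  filter_upwards [compl_mem_ae_iff.2 (measure_singleton p)] with s hsp hs
  have hs' : s ∈ Ioo a p := ⟨hs.1, lt_of_le_of_ne hs.2 hsp⟩
  have hpos : 0 ≤ (p - s) ^ (-α) := rpow_nonneg (by linarith [hs.2]) _
  rw [Real.norm_eq_abs, abs_mul, abs_of_nonneg hpos, mul_comm]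
  gcongr
  exact hg s hs'

theorem weighted_kernel_le {α γ p s τ : ℝ} (hα0 : 0 < α) (hγ : 0 ≤ γ) (hτ : 0 < τ) (hs : 0 < s)
    (hsp : s < p) :
    s ^ α * (τ / s) ^ γ * (p - s) ^ (-α - 1) ≤
      (p / 2) ^ (-α - 1) * (s ^ α * (τ / s) ^ γ) +
        p ^ α * (τ / (p / 2)) ^ γ * (p - s) ^ (-α - 1) := by
  have hp : 0 < p := hs.trans hsp
  have hps : 0 < p - s := sub_pos.2 hsp
  rcases le_total s (p / 2) with h | h
  · have h1 : (p - s) ^ (-α - 1) ≤ (p / 2) ^ (-α - 1) :=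
      rpow_le_rpow_of_nonpos (by positivity) (by linarith) (by linarith)
    have h2 : s ^ α * (τ / s) ^ γ * (p - s) ^ (-α - 1) ≤
      s ^ α * (τ / s) ^ γ * (p / 2) ^ (-α - 1) := by gcongr
    have h3 : 0 ≤ p ^ α * (τ / (p / 2)) ^ γ * (p - s) ^ (-α - 1) := by positivity
    linarith
  · have h2 : s ^ α * (τ / s) ^ γ * (p - s) ^ (-α - 1) ≤
      p ^ α * (τ / (p / 2)) ^ γ * (p - s) ^ (-α - 1) := by gcongr
    have h3 : 0 ≤ (p / 2) ^ (-α - 1) * (s ^ α * (τ / s) ^ γ) := by positivity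
    linarith

theorem continuousOn_graded_kernel {α γ τ a b : ℝ} (hτ : 0 < τ) (ha : 0 < a) :
    ContinuousOn (fun s => s ^ α * (τ / s) ^ γ) (Icc a b) := by
  have hpos : ∀ s ∈ Icc a b, 0 < s := fun s hs => ha.trans_le hs.1
  refine (continuousOn_id.rpow_const fun s hs => Or.inl (hpos s hs).ne').mul ?_
  exact (continuousOn_const.div continuousOn_id fun s hs => (hpos s hs).ne').rpow_const
    fun s hs => Or.inl (div_pos hτ (hpos s hs)).ne'

theorem integral_weighted_kernel_le {α r D : ℝ} (hα0 : 0 < α) (hα1 : α < 1) (hr1 : 1 ≤ r)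
    (hD : 1 ≤ D) :
    ∃ C : ℝ, 0 < C ∧ ∀ τ x p z : ℝ, 0 < τ → τ ≤ x → x < p → p ≤ z → z ≤ 2 * p →
      z * (τ / z) ^ (1 / r) ≤ 2 * D * (p - x) →
      ∫ s in τ..x, s ^ α * (τ / s) ^ (3 / r) * (p - s) ^ (-α - 1) ≤
        C * (τ / z) ^ min (α + 1) ((3 - α) / r) := by
  have hr0 : 0 < r := by linarith
  set β := min (α + 1) ((3 - α) / r) with hβ
  have hlt : (3 - α) / r < 3 / r := by gcongr; linarith
  have hβ1 : β ≤ α + 1 := min_le_left _ _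
  have hβ2 : β ≤ (3 - α) / r := min_le_right _ _
  have hβ0 : 0 < β := lt_min (by linarith) (div_pos (by linarith) hr0)
  obtain ⟨C, hC, hker⟩ := integral_graded_kernel_le (γ := 3 / r) hα0 (hβ2.trans hlt.le) hβ1
    (fun _ => hβ2.trans_lt hlt)
  refine ⟨2 ^ (α + 1) * C * 2 ^ β + 4 ^ (3 / r) * (2 * D) ^ α / α, by positivity, ?_⟩
  intro τ x p z hτ hx hxp hpz hzp hgap
  have hx0 : 0 < x := hτ.trans_le hx
  have hp0 : 0 < p := hx0.trans hxp
  have hz0 : 0 < z := hp0.trans_le hpz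
  have hpx : 0 < p - x := sub_pos.2 hxp
  have hy0 : 0 < τ / z := div_pos hτ hz0
  have hy1 : τ / z ≤ 1 := (div_le_one hz0).2 (by linarith)
  have hg := continuousOn_graded_kernel (α := α) (γ := 3 / r) (b := x) hτ hτ
  have hw := continuousOn_sub_rpow (a := τ) hxp (-α - 1)
  have i1 : IntervalIntegrable (fun s => (p / 2) ^ (-α - 1) * (s ^ α * (τ / s) ^ (3 / r)))
    volume τ x := (hg.intervalIntegrable_of_Icc hx).const_mul _
  have i2 : IntervalIntegrable (fun s => p ^ α * (τ / (p / 2)) ^ (3 / r) * (p - s) ^ (-α - 1))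
    volume τ x := (hw.intervalIntegrable_of_Icc hx).const_mul _
  have step : ∫ s in τ..x, s ^ α * (τ / s) ^ (3 / r) * (p - s) ^ (-α - 1) ≤
      (p / 2) ^ (-α - 1) * (∫ s in τ..x, s ^ α * (τ / s) ^ (3 / r)) +
      (p ^ α * (τ / (p / 2)) ^ (3 / r)) * ∫ s in τ..x, (p - s) ^ (-α - 1) := by
    rw [← intervalIntegral.integral_const_mul, ← intervalIntegral.integral_const_mul,
      ← intervalIntegral.integral_add i1 i2]
    exact intervalIntegral.integral_mono_on hx ((hg.mul hw).intervalIntegrable_of_Icc hx)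
      (i1.add i2) fun s hs => weighted_kernel_le hα0 (by positivity) hτ (hτ.trans_le hs.1)
        (hs.2.trans_lt hxp)
  have b1 : (p / 2) ^ (-α - 1) * ∫ s in τ..x, s ^ α * (τ / s) ^ (3 / r) ≤
      2 ^ (α + 1) * C * 2 ^ β * (τ / z) ^ β := by
    have m1 : x ^ (α + 1) * (τ / x) ^ β ≤ p ^ (α + 1) * (τ / p) ^ β := by
      have e : ∀ x : ℝ, 0 < x → x ^ (α + 1) * (τ / x) ^ β = x ^ (α + 1 - β) * τ ^ β := by
        intro x hx
        rw [div_rpow hτ.le hx.le, rpow_sub hx]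
        ring
      rw [e x hx0, e p hp0]
      gcongr
    have m2 : τ / p ≤ 2 * (τ / z) := by
      rw [mul_div_assoc', div_le_div_iff₀ hp0 hz0]
      nlinarith
    have m3 : (p / 2) ^ (-α - 1) * p ^ (α + 1) = 2 ^ (α + 1) := by
      rw [show -α - 1 = -(α + 1) by ring, rpow_neg (by positivity), div_rpow hp0.le zero_le_two]
      have := rpow_pos_of_pos hp0 (α + 1)
      field_simp
    calc (p / 2) ^ (-α - 1) * ∫ s in τ..x, s ^ α * (τ / s) ^ (3 / r)
        ≤ (p / 2) ^ (-α - 1) * (C * (p ^ (α + 1) * (τ / p) ^ β)) := by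
          gcongr
          exact (hker τ x hτ hx).trans (by gcongr)
      _ = ((p / 2) ^ (-α - 1) * p ^ (α + 1)) * C * (τ / p) ^ β := by ring
      _ ≤ 2 ^ (α + 1) * C * (2 * (τ / z)) ^ β := by rw [m3]; gcongr
      _ = _ := by rw [mul_rpow zero_le_two hy0.le]; ring
  have b2 : (p ^ α * (τ / (p / 2)) ^ (3 / r)) * ∫ s in τ..x, (p - s) ^ (-α - 1) ≤
      4 ^ (3 / r) * (2 * D) ^ α / α * (τ / z) ^ β := by
    have m1 : τ / (p / 2) ≤ 4 * (τ / z) := by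
      rw [mul_div_assoc', div_le_div_iff₀ (by positivity) hz0]
      nlinarith
    have m2 : (p - x) ^ (-α) ≤ (z * (τ / z) ^ (1 / r) / (2 * D)) ^ (-α) :=
      rpow_le_rpow_of_nonpos (by positivity) (by rw [div_le_iff₀ (by positivity)]; linarith)
        (by linarith)
    have m3 : (z * (τ / z) ^ (1 / r) / (2 * D)) ^ (-α) =
        z ^ (-α) * (τ / z) ^ (-(α / r)) * (2 * D) ^ α := by
      rw [div_rpow (by positivity) (by positivity), mul_rpow hz0.le (by positivity),
        ← rpow_mul hy0.le, rpow_neg (by positivity : 0 ≤ 2 * D), div_inv_eq_mul]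
      congr 3; ring
    have m4 : (τ / z) ^ (3 / r) * (τ / z) ^ (-(α / r)) ≤ (τ / z) ^ β := by
      rw [← rpow_add hy0]
      refine rpow_le_rpow_of_exponent_ge hy0 hy1 (hβ2.trans_eq ?_)
      ring
    have m5 : z ^ α * z ^ (-α) = 1 := by rw [← rpow_add hz0, add_neg_cancel, rpow_zero]
    calc (p ^ α * (τ / (p / 2)) ^ (3 / r)) * ∫ s in τ..x, (p - s) ^ (-α - 1)
        ≤ (z ^ α * (4 * (τ / z)) ^ (3 / r)) *
          (z ^ (-α) * (τ / z) ^ (-(α / r)) * (2 * D) ^ α / α) := by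
          rw [← m3]
          have := (integral_sub_rpow_neg_sub_one_le hα0 hx hxp).trans
            (div_le_div_of_nonneg_right m2 hα0.le)
          refine mul_le_mul (by gcongr) this ?_ (by positivity)
          exact intervalIntegral.integral_nonneg hx
            fun s hs => rpow_nonneg (by linarith [hs.2]) _
      _ = (z ^ α * z ^ (-α)) * (4 ^ (3 / r) * (2 * D) ^ α / α) *
          ((τ / z) ^ (3 / r) * (τ / z) ^ (-(α / r))) := by
          rw [mul_rpow (by norm_num) hy0.le]; ring
      _ ≤ _ := by
          rw [m5, one_mul]
          gcongr
  rw [add_mul]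
  exact step.trans (add_le_add b1 b2)

/-- The local consequences of quasi-gradedness used by the truncation analysis, with all constants
collected in a single `D`. -/
structure LocallyGraded (D r : ℝ) (M : ℕ) (t : ℕ → ℝ) : Prop where
  zero : t 0 = 0
  lt_succ : ∀ j, j < M → t j < t (j + 1)
  succ_le : ∀ j, 1 ≤ j → j < M → t (j + 1) ≤ D * t j
  two_step_le : ∀ j, 1 ≤ j → j < M → t (j + 1) - t (j - 1) ≤ D * (t (j + 1) - t j)
  two_step_le_graded : ∀ j, 1 ≤ j → j < M →
    t (j + 1) - t (j - 1) ≤ D * (t j * (t 1 / t j) ^ (1 / r))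
  graded_le_step : ∀ j, 1 ≤ j → j < M →
    t (j + 1) * (t 1 / t (j + 1)) ^ (1 / r) ≤ D * (t (j + 1) - t j)

theorem LocallyGraded.lt {D r : ℝ} {M : ℕ} {t : ℕ → ℝ} (h : LocallyGraded D r M t) {i j : ℕ}
    (hij : i < j) (hj : j ≤ M) : t i < t j := by
  induction j, hij using Nat.le_induction with
  | base => exact h.lt_succ i hj
  | succ k hk ih => exact (ih (by omega)).trans (h.lt_succ k hj)

theorem LocallyGraded.le {D r : ℝ} {M : ℕ} {t : ℕ → ℝ} (h : LocallyGraded D r M t) {i j : ℕ}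
    (hij : i ≤ j) (hj : j ≤ M) : t i ≤ t j := by
  rcases hij.eq_or_lt with rfl | h'
  · rfl
  · exact (h.lt h' hj).le

theorem LocallyGraded.pos {D r : ℝ} {M : ℕ} {t : ℕ → ℝ} (h : LocallyGraded D r M t) {j : ℕ}
    (h1 : 1 ≤ j) (hj : j ≤ M) : 0 < t j := by
  rw [← h.zero]; exact h.lt h1 hj

theorem QuasiGraded.exists_locallyGraded {r c0 C0 : ℝ} (hr1 : 1 ≤ r) (hc0 : 0 < c0)
    (hcC : c0 ≤ C0) :
    ∃ D : ℝ, 1 ≤ D ∧ ∀ (T : ℝ) (M : ℕ) (t : ℕ → ℝ), IsMesh T M t → QuasiGraded r c0 C0 M t →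
      LocallyGraded D r M t := by
  have hC0 : 0 < C0 := hc0.trans_le hcC
  set D1 := C0 * 2 ^ r / c0 with hD1
  set L := 1 + C0 / c0 with hL
  have hD1p : 0 < D1 := by positivity
  have hLp : 0 < L := by positivity
  have hci : 0 < 1 / c0 := by positivity
  have hLC : 0 < L * C0 * D1 := by positivity
  refine ⟨1 + D1 + L + L * C0 * D1 + 1 / c0, by linarith, ?_⟩
  rintro T M t ⟨hM, hzero, hlt, -⟩ ⟨-, hq, hs⟩
  set D := 1 + D1 + L + L * C0 * D1 + 1 / c0 with hD
  have hpos : ∀ j, 1 ≤ j → j ≤ M → 0 < t j := by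
    intro j hj
    induction j, hj using Nat.le_induction with
    | base => intro h; have := hlt 0 (by omega); rwa [hzero] at this
    | succ k hk ih => intro h; exact (ih (by omega)).trans (hlt k (by omega))
  have ht1 := hpos 1 le_rfl (by omega)
  have hρ : ∀ x, 0 < x → t 1 ^ (1 / r) * x ^ (1 - 1 / r) = x * (t 1 / x) ^ (1 / r) := by
    intro x hx
    rw [rpow_sub hx, rpow_one, div_rpow ht1.le hx.le]
    ring
  have hsucc : ∀ j, 1 ≤ j → j < M → t (j + 1) ≤ D1 * t j := by
    intro j hj hjM
    have h1 := (hq (j + 1) (by omega) (by omega)).2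
    have h2 := (hq j hj hjM.le).1
    have hj1 : (1 : ℝ) ≤ j := by exact_mod_cast hj
    have h3 : (((j + 1 : ℕ) : ℝ)) ^ r ≤ 2 ^ r * (j : ℝ) ^ r := by
      rw [← mul_rpow zero_le_two (by positivity)]
      refine rpow_le_rpow (by positivity) ?_ (by linarith)
      push_cast; linarith
    calc t (j + 1) ≤ C0 * (t 1 * (2 ^ r * (j : ℝ) ^ r)) := h1.trans (by gcongr)
      _ = D1 * (c0 * (t 1 * (j : ℝ) ^ r)) := by rw [hD1]; field_simp
      _ ≤ D1 * t j := by gcongr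
  have hr0 : 0 ≤ 1 / r := by positivity
  have hr1' : 1 / r ≤ 1 := (div_le_one (by linarith)).2 hr1
  have htwo : ∀ j, 1 ≤ j → j < M → t (j + 1) - t (j - 1) ≤ L * (t (j + 1) - t j) := by
    intro j hj hjM
    have h1 := (hs j hj hjM.le).2
    have h2 := (hs (j + 1) (by omega) (by omega)).1
    rw [add_tsub_cancel_right] at h2
    have hp := hpos j hj hjM.le
    have h3 : t j ^ (1 - 1 / r) ≤ t (j + 1) ^ (1 - 1 / r) :=
      rpow_le_rpow hp.le (hlt j hjM).le (by linarith)
    have h4 : t j - t (j - 1) ≤ C0 / c0 * (t (j + 1) - t j) := by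
      calc t j - t (j - 1) ≤ C0 * (t 1 ^ (1 / r) * t (j + 1) ^ (1 - 1 / r)) :=
            h1.trans (by gcongr)
        _ = C0 / c0 * (c0 * (t 1 ^ (1 / r) * t (j + 1) ^ (1 - 1 / r))) := by field_simp
        _ ≤ _ := by gcongr
    rw [hL]; linarith
  refine ⟨hzero, hlt, fun j hj hjM => ?_, fun j hj hjM => ?_, fun j hj hjM => ?_,
    fun j hj hjM => ?_⟩
  · have hp := hpos j hj hjM.le
    refine (hsucc j hj hjM).trans ?_
    gcongr
    linarith
  · have := sub_pos.2 (hlt j hjM)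
    refine (htwo j hj hjM).trans ?_
    gcongr
    linarith
  · have hp := hpos j hj hjM.le
    have hp' := hpos (j + 1) (by omega) hjM
    have h1 := (hs (j + 1) (by omega) (by omega)).2
    rw [add_tsub_cancel_right, hρ _ hp'] at h1
    have hlt' := hlt j hjM
    calc t (j + 1) - t (j - 1) ≤ L * (C0 * (t (j + 1) * (t 1 / t (j + 1)) ^ (1 / r))) :=
          (htwo j hj hjM).trans (by gcongr)
      _ ≤ L * (C0 * (D1 * t j * (t 1 / t j) ^ (1 / r))) := by
          have := hsucc j hj hjM
          gcongr
      _ = L * C0 * D1 * (t j * (t 1 / t j) ^ (1 / r)) := by ring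
      _ ≤ _ := by
          gcongr
          linarith
  · have hp' := hpos (j + 1) (by omega) hjM
    have h1 := (hs (j + 1) (by omega) (by omega)).1
    rw [add_tsub_cancel_right, hρ _ hp'] at h1
    have := sub_pos.2 (hlt j hjM)
    calc _ = 1 / c0 * (c0 * (t (j + 1) * (t 1 / t (j + 1)) ^ (1 / r))) := by field_simp
      _ ≤ 1 / c0 * (t (j + 1) - t j) := by gcongr
      _ ≤ _ := by gcongr; linarith

theorem rpow_le_mul_rpow {a b D q : ℝ} (hD : 1 ≤ D) (ha : 0 ≤ a) (hb : 0 ≤ b) (h : b ≤ D * a)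
    (hq0 : 0 ≤ q) (hq1 : q ≤ 1) : b ^ q ≤ D * a ^ q := by
  calc b ^ q ≤ (D * a) ^ q := rpow_le_rpow hb h hq0
    _ = D ^ q * a ^ q := mul_rpow (by linarith) ha
    _ ≤ D ^ (1 : ℝ) * a ^ q := by gcongr
    _ = _ := by rw [rpow_one]

/-- Regularity of `u` up to time level `m`, measured by a single constant `S`. -/
structure GradedRegularity (α S : ℝ) (M : ℕ) (t : ℕ → ℝ) (u : ℝ → ℝ) (m : ℕ) : Prop where
  continuousOn : ContinuousOn u (Icc 0 (t M))
  diff_zero : ∀ x ∈ Ioo 0 (t M), DifferentiableAt ℝ u x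
  diff_one : ∀ x ∈ Ioo 0 (t M), DifferentiableAt ℝ (deriv u) x
  diff_two : ∀ x ∈ Ioo 0 (t M), DifferentiableAt ℝ (deriv (deriv u)) x
  deriv_le : ∀ s ∈ Ioo 0 (t 2), |deriv u s| ≤ S * s ^ (α - 1)
  osc_le : ∀ x ∈ Icc 0 (t 2), ∀ y ∈ Icc 0 (t 2), |u x - u y| ≤ S * t 2 ^ α
  third_le : ∀ j, 2 ≤ j → j < m → ∀ s ∈ Ioo (t (j - 1)) (t (j + 1)),
    |deriv (deriv (deriv u)) s| ≤ S * t j ^ (α - 3)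

theorem GradedRegularity.continuousOn_deriv {α S : ℝ} {M m : ℕ} {t : ℕ → ℝ} {u : ℝ → ℝ}
    (h : GradedRegularity α S M t u m) : ContinuousOn (deriv u) (Ioo 0 (t M)) :=
  fun x hx => (h.diff_one x hx).continuousAt.continuousWithinAt

theorem GradedRegularity.intervalIntegrable_deriv {α S D r : ℝ} {M m : ℕ} {t : ℕ → ℝ} {u : ℝ → ℝ}
    (h : GradedRegularity α S M t u m) (hg : LocallyGraded D r M t) (hM : 2 ≤ M) (hα0 : 0 < α)
    {j : ℕ} (hj : j + 1 < M) : IntervalIntegrable (deriv u) volume (t j) (t (j + 1)) := by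
  rcases Nat.eq_zero_or_pos j with rfl | hj0
  · have h12 := hg.lt (i := 1) (j := 2) (by norm_num) hM
    have h01 := hg.pos (j := 1) le_rfl (by omega)
    rw [hg.zero, zero_add]
    refine IntervalIntegrable.mono_fun' (g := fun s => S * s ^ (α - 1))
      ((intervalIntegral.intervalIntegrable_rpow' (by linarith)).const_mul S)
      (measurable_deriv u).aestronglyMeasurable ?_
    refine (ae_restrict_iff' measurableSet_uIoc).2 (ae_of_all _ fun s hs => ?_)
    rw [uIoc_of_le h01.le] at hs
    exact h.deriv_le s ⟨hs.1, hs.2.trans_lt h12⟩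
  · refine (h.continuousOn_deriv.mono fun s hs => ?_).intervalIntegrable_of_Icc
      (hg.lt_succ j (by omega)).le
    exact ⟨(hg.pos hj0 (by omega)).trans_le hs.1, hs.2.trans_lt (hg.lt hj le_rfl)⟩

theorem GradedRegularity.abs_interior_error_le {α S D r p : ℝ} {M m j : ℕ} {t : ℕ → ℝ} {u : ℝ → ℝ}
    (h : GradedRegularity α S M t u m) (hg : LocallyGraded D r M t) (hM : 2 ≤ M) (hmM : m ≤ M)
    (hα0 : 0 < α) (hα1 : α < 1) (hr1 : 1 ≤ r) (hD : 1 ≤ D) (hS : 0 ≤ S)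
    (hj : 1 ≤ j) (hjm : j + 1 < m) (hp : t (j + 1) < p) :
    |∫ s in (t j)..(t (j + 1)), (p - s) ^ (-α) *
        (deriv (fun x => lagQuad (t j) (t (j + 1)) (t (j + 2)) (u (t j)) (u (t (j + 1)))
          (u (t (j + 2))) x) s - deriv u s)| ≤
      ∫ s in (t j)..(t (j + 1)), α * (2 + 2 * D) * D ^ 4 * S *
        (s ^ α * (t 1 / s) ^ (3 / r) * (p - s) ^ (-α - 1)) := by
  have h0 := hg.pos hj (by omega)
  have h1 := hg.pos (j := j + 1) (by omega) (by omega)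
  have ht1 := hg.pos (j := 1) le_rfl (by omega)
  have h01 := hg.lt_succ j (by omega)
  have h12 := hg.lt_succ (j + 1) (by omega)
  have h2M := hg.le (i := j + 2) (j := M) (by omega) le_rfl
  have hsub : ∀ x ∈ Ioo (t j) (t (j + 2)), x ∈ Ioo 0 (t M) := fun x hx =>
    ⟨h0.trans hx.1, hx.2.trans_le h2M⟩
  obtain ⟨A, B, E, -, hY⟩ := exists_quadratic_approx (a := t j) (b := t (j + 2)) (c := t (j + 1))
    (h.continuousOn.mono (Icc_subset_Icc h0.le h2M)) (fun x hx => h.diff_zero x (hsub x hx))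
    (fun x hx => h.diff_one x (hsub x hx)) (fun x hx => h.diff_two x (hsub x hx))
    (h.third_le (j + 1) (by omega) hjm) ⟨h01, h12⟩
  refine (abs_integral_lagQuad_error_le hα0 h01 h12
    (by simpa using hg.two_step_le (j + 1) (by omega) (by omega)) hp
    (h.continuousOn.mono (Icc_subset_Icc h0.le (h12.le.trans h2M)))
    (fun x hx => h.diff_zero x (hsub x ⟨hx.1, hx.2.trans h12⟩))
    (h.intervalIntegrable_deriv hg hM hα0 (by omega)) hY).trans ?_
  have hker := (continuousOn_graded_kernel (α := α) (γ := 3 / r) (b := t (j + 1)) ht1 h0)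
  have hw := continuousOn_sub_rpow (a := t j) hp (-α - 1)
  refine intervalIntegral.integral_mono_on h01.le
    ((intervalIntegrable_sub_rpow h01.le hp _).const_mul _)
    (((hker.mul hw).intervalIntegrable_of_Icc h01.le).const_mul _) fun s hs => ?_
  have hs0 : 0 < s := h0.trans_le hs.1
  have hps : 0 ≤ (p - s) ^ (-α - 1) := rpow_nonneg (by linarith [hs.2]) _
  have hH : t (j + 2) - t j ≤ D * (t (j + 1) * (t 1 / t (j + 1)) ^ (1 / r)) := by
    simpa using hg.two_step_le_graded (j + 1) (by omega) (by omega)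
  have hy : 0 < t 1 / t (j + 1) := div_pos ht1 h1
  have b1 : S * t (j + 1) ^ (α - 3) * (t (j + 2) - t j) ^ 3 ≤
      S * D ^ 3 * (t (j + 1) ^ α * (t 1 / t (j + 1)) ^ (3 / r)) := by
    calc S * t (j + 1) ^ (α - 3) * (t (j + 2) - t j) ^ 3
        ≤ S * t (j + 1) ^ (α - 3) * (D * (t (j + 1) * (t 1 / t (j + 1)) ^ (1 / r))) ^ 3 := by
          have : 0 ≤ t (j + 2) - t j := by linarith
          gcongr
      _ = S * D ^ 3 * ((t (j + 1) ^ (α - 3) * t (j + 1) ^ (3 : ℕ)) *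
            ((t 1 / t (j + 1)) ^ (1 / r)) ^ (3 : ℕ)) := by ring
      _ = _ := by
          rw [← rpow_natCast (t (j + 1)) 3, ← rpow_add h1,
            ← rpow_natCast ((t 1 / t (j + 1)) ^ (1 / r)) 3, ← rpow_mul hy.le]
          congr 3
          · push_cast; ring
          · push_cast; ring
  have b2 : t (j + 1) ^ α ≤ D * s ^ α :=
    rpow_le_mul_rpow hD hs0.le h1.le ((hg.succ_le j hj (by omega)).trans
      (mul_le_mul_of_nonneg_left hs.1 (by linarith))) hα0.le hα1.le
  have b3 : (t 1 / t (j + 1)) ^ (3 / r) ≤ (t 1 / s) ^ (3 / r) := by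
    refine rpow_le_rpow hy.le ?_ (by positivity)
    have := hs.2
    gcongr
  have b4 : S * t (j + 1) ^ (α - 3) * (t (j + 2) - t j) ^ 3 ≤
      S * D ^ 3 * ((D * s ^ α) * (t 1 / s) ^ (3 / r)) := b1.trans (by gcongr)
  refine (mul_le_mul_of_nonneg_right (mul_le_mul_of_nonneg_left
    (mul_le_mul_of_nonneg_left b4 (by positivity : 0 ≤ 2 + 2 * D)) hα0.le) hps).trans_eq ?_
  ring

theorem GradedRegularity.abs_first_error_le {α S D r p : ℝ} {M m n : ℕ} {t : ℕ → ℝ} {u : ℝ → ℝ}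
    (h : GradedRegularity α S M t u m) (hg : LocallyGraded D r M t) (hnM : n + 2 ≤ M)
    (hα0 : 0 < α) (hα1 : α < 1) (hD : 1 ≤ D) (hS : 0 ≤ S)
    (hp : t (n + 2) + t (n + 1) ≤ 2 * p) :
    |∫ s in (t 0)..(t 1), (p - s) ^ (-α) *
        (deriv (fun x => lagQuad (t 0) (t 1) (t 2) (u (t 0)) (u (t 1)) (u (t 2)) x) s -
          deriv u s)| ≤
      α * (2 + 2 * D) * D * (2 * D) ^ (α + 1) * (S * (t 1 / t (n + 2)) ^ (α + 1)) := by
  have hD0 : 0 < D := by linarith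
  have h1 := hg.pos (j := 1) le_rfl (by omega)
  have hz := hg.pos (j := n + 2) (by omega) hnM
  have h12 := hg.lt (i := 1) (j := 2) (by omega) (by omega)
  have h2M := hg.le (i := 2) (j := M) (by omega) le_rfl
  have h2z := hg.le (i := 2) (j := n + 2) (by omega) hnM
  have h1n := hg.le (i := 1) (j := n + 1) (by omega) (by omega)
  have hgap : t (n + 2) / (2 * D) ≤ p - t 1 := by
    have h := hg.two_step_le 1 le_rfl (by omega)
    simp only [Nat.reduceAdd, Nat.sub_self, hg.zero, sub_zero] at h
    rw [div_le_iff₀ (by positivity)]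
    nlinarith
  have hpos : 0 < t (n + 2) / (2 * D) := by positivity
  have hp1 : t 1 < p := by linarith
  refine (abs_integral_lagQuad_error_le (Λ := D) (Y := S * t 2 ^ α) (A := u 0) (B := 0) (E := 0)
    (c := 0) hα0 (hg.lt_succ 0 (by omega)) h12
    (by simpa using hg.two_step_le 1 le_rfl (by omega)) hp1
    (h.continuousOn.mono (Icc_subset_Icc hg.zero.ge (h12.le.trans h2M)))
    (fun x hx => h.diff_zero x ⟨hg.zero.symm.trans_lt hx.1, hx.2.trans (h12.trans_le h2M)⟩)
    ?_ fun x hx => ?_).trans ?_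
  · rw [hg.zero]
    refine IntervalIntegrable.mono_fun' (g := fun s => S * s ^ (α - 1))
      ((intervalIntegral.intervalIntegrable_rpow' (by linarith)).const_mul S)
      (measurable_deriv u).aestronglyMeasurable ?_
    refine (ae_restrict_iff' measurableSet_uIoc).2 (ae_of_all _ fun s hs => ?_)
    rw [uIoc_of_le h1.le] at hs
    exact h.deriv_le s ⟨hs.1, hs.2.trans_lt h12⟩
  · rw [hg.zero] at hx
    simpa using h.osc_le x hx 0 ⟨le_rfl, (h1.trans h12).le⟩
  · rw [hg.zero]
    set Q := α * ((2 + 2 * D) * (S * t 2 ^ α)) with hQ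
    have h2 : 0 ≤ t 2 ^ α := rpow_nonneg (h1.trans h12).le _
    have hQ0 : 0 ≤ Q := by positivity
    have hbd : ∀ s ∈ uIoc 0 (t 1), ‖Q * (p - s) ^ (-α - 1)‖ ≤
        Q * (t (n + 2) / (2 * D)) ^ (-α - 1) := by
      intro s hs
      rw [uIoc_of_le h1.le] at hs
      have hps : t (n + 2) / (2 * D) ≤ p - s := by linarith [hs.2]
      have : 0 ≤ (p - s) ^ (-α - 1) := rpow_nonneg (hpos.le.trans hps) _
      rw [Real.norm_eq_abs, abs_of_nonneg (by positivity)]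
      exact mul_le_mul_of_nonneg_left (rpow_le_rpow_of_nonpos hpos hps (by linarith)) hQ0
    refine (le_abs_self _).trans ((intervalIntegral.norm_integral_le_of_norm_le_const hbd).trans ?_)
    rw [sub_zero, abs_of_pos h1]
    have hb2 : t 2 ^ α ≤ D * t 1 ^ α :=
      rpow_le_mul_rpow hD h1.le (h1.trans h12).le (hg.succ_le 1 le_rfl (by omega)) hα0.le hα1.le
    have e1 : (t (n + 2) / (2 * D)) ^ (-α - 1) * (t 1 ^ α * t 1) =
        (2 * D) ^ (α + 1) * (t 1 / t (n + 2)) ^ (α + 1) := by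
      rw [show -α - 1 = -(α + 1) by ring, rpow_neg hpos.le, div_rpow hz.le (by positivity),
        div_rpow h1.le hz.le, rpow_add h1, rpow_one]
      have := rpow_pos_of_pos hz (α + 1)
      field_simp
    calc Q * (t (n + 2) / (2 * D)) ^ (-α - 1) * t 1
        ≤ α * ((2 + 2 * D) * (S * (D * t 1 ^ α))) * (t (n + 2) / (2 * D)) ^ (-α - 1) * t 1 := by
          rw [hQ]; gcongr
      _ = α * (2 + 2 * D) * D * S * ((t (n + 2) / (2 * D)) ^ (-α - 1) * (t 1 ^ α * t 1)) := by ring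
      _ = _ := by rw [e1]; ring

theorem GradedRegularity.abs_sum_interior_error_le {α r D : ℝ} (hα0 : 0 < α) (hα1 : α < 1)
    (hr1 : 1 ≤ r) (hD : 1 ≤ D) :
    ∃ C : ℝ, 0 < C ∧ ∀ (S p : ℝ) (M n : ℕ) (t : ℕ → ℝ) (u : ℝ → ℝ),
      GradedRegularity α S M t u (n + 2) → LocallyGraded D r M t → n + 2 ≤ M → 0 ≤ S →
      t (n + 2) + t (n + 1) ≤ 2 * p → p ≤ t (n + 2) →
      |∑ i ∈ Finset.range n, ∫ s in (t (i + 1))..(t (i + 2)), (p - s) ^ (-α) *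
        (deriv (fun x => lagQuad (t (i + 1)) (t (i + 2)) (t (i + 3)) (u (t (i + 1)))
          (u (t (i + 2))) (u (t (i + 3))) x) s - deriv u s)| ≤
      C * (S * (t 1 / t (n + 2)) ^ min (α + 1) ((3 - α) / r)) := by
  obtain ⟨C, hC, hint⟩ := integral_weighted_kernel_le hα0 hα1 hr1 hD
  have hD0 : 0 < D := by linarith
  refine ⟨α * (2 + 2 * D) * D ^ 4 * C, by positivity, ?_⟩
  intro S p M n t u h hg hnM hS hp hpz
  have h1 := hg.pos (j := 1) le_rfl (by omega)
  have hx1 := hg.le (i := 1) (j := n + 1) (by omega) (by omega)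
  have hxz := hg.lt_succ (n + 1) (by omega)
  have hxp : t (n + 1) < p := by linarith
  set K := fun s => s ^ α * (t 1 / s) ^ (3 / r) * (p - s) ^ (-α - 1) with hK
  have hadj : ∑ i ∈ Finset.range n, ∫ s in (t (i + 1))..(t (i + 2)), K s =
      ∫ s in (t 1)..(t (n + 1)), K s := by
    refine intervalIntegral.sum_integral_adjacent_intervals (a := fun k => t (k + 1))
      fun k hk => ?_
    have hkl := hg.lt_succ (k + 1) (by omega)
    have hkp : t (k + 1 + 1) < p := (hg.le (by omega) (by omega)).trans_lt hxp
    exact ((continuousOn_graded_kernel h1 (hg.pos (by omega) (by omega))).mul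
      (continuousOn_sub_rpow hkp _)).intervalIntegrable_of_Icc hkl.le
  calc _ ≤ ∑ i ∈ Finset.range n, ∫ s in (t (i + 1))..(t (i + 2)),
        α * (2 + 2 * D) * D ^ 4 * S * K s := by
        refine (Finset.abs_sum_le_sum_abs _ _).trans (Finset.sum_le_sum fun i hi => ?_)
        have hi' := Finset.mem_range.1 hi
        exact h.abs_interior_error_le hg (by omega) hnM hα0 hα1 hr1 hD hS (by omega) (by omega)
          ((hg.le (by omega) (by omega)).trans_lt hxp)
    _ = α * (2 + 2 * D) * D ^ 4 * S * ∫ s in (t 1)..(t (n + 1)), K s := by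
        simp only [intervalIntegral.integral_const_mul, ← Finset.mul_sum, hadj]
    _ ≤ α * (2 + 2 * D) * D ^ 4 * S *
          (C * (t 1 / t (n + 2)) ^ min (α + 1) ((3 - α) / r)) := by
        refine mul_le_mul_of_nonneg_left (hint (t 1) (t (n + 1)) p (t (n + 2)) h1 hx1 hxp hpz
          (by linarith) ((hg.graded_le_step (n + 1) (by omega) (by omega)).trans ?_))
          (by positivity)
        nlinarith
    _ = _ := by ring

theorem GradedRegularity.abs_last_error_le {α S D r : ℝ} {M n : ℕ} {t : ℕ → ℝ} {u : ℝ → ℝ}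
    (h : GradedRegularity α S M t u (n + 3)) (hg : LocallyGraded D r M t) (hnM : n + 3 ≤ M)
    (hα0 : 0 < α) (hα1 : α < 1) (hr1 : 1 ≤ r) (hD : 1 ≤ D) (hS : 0 ≤ S) :
    |∫ s in (t (n + 2))..(tStar α t (n + 3)), (tStar α t (n + 3) - s) ^ (-α) *
        ((u (t (n + 3)) - u (t (n + 2))) / (t (n + 3) - t (n + 2)) - deriv u s)| ≤
      2 / (1 - α) * D ^ (3 - α) * D ^ ((3 - α) / r) *
        (S * (t 1 / t (n + 3)) ^ ((3 - α) / r)) := by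
  have hD0 : 0 < D := by linarith
  have hα' : 0 < 1 - α := by linarith
  have h1 := hg.pos (j := 1) le_rfl (by omega)
  have ha := hg.pos (j := n + 2) (by omega) (by omega)
  have hb := hg.pos (j := n + 3) (by omega) (by omega)
  have hab := hg.lt_succ (n + 2) (by omega)
  have hpa := hg.lt_succ (n + 1) (by omega)
  have hbM := hg.le (i := n + 3) (j := M) hnM le_rfl
  have hps : tStar α t (n + 3) = t (n + 3) - α / 2 * (t (n + 3) - t (n + 2)) := rfl
  have hsub : ∀ x ∈ Ioo (t (n + 2)) (t (n + 3)), x ∈ Ioo 0 (t M) := fun x hx =>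
    ⟨ha.trans hx.1, hx.2.trans_le hbM⟩
  rw [hps]
  have hpb : t (n + 3) - α / 2 * (t (n + 3) - t (n + 2)) < t (n + 3) := by nlinarith
  refine (abs_integral_linear_error_le hα0 hα1 hab
    (h.continuousOn.mono (Icc_subset_Icc ha.le hbM))
    (h.continuousOn_deriv.mono fun s hs => ⟨ha.trans_le hs.1, hs.2.trans_lt (hpb.trans_le hbM)⟩)
    (fun x hx => h.diff_zero x (hsub x hx)) (fun x hx => h.diff_one x (hsub x hx))
    (fun x hx => h.diff_two x (hsub x hx))
    (K := S * t (n + 2) ^ (α - 3))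
    (fun x hx => h.third_le (n + 2) (by omega) (by omega) x ⟨hpa.trans hx.1, hx.2⟩)).trans ?_
  have hy : 0 < t 1 / t (n + 2) := by positivity
  have hstep : t (n + 3) - t (n + 2) ≤ D * (t (n + 2) * (t 1 / t (n + 2)) ^ (1 / r)) := by
    have := hg.two_step_le_graded (n + 2) (by omega) (by omega)
    simp only [Nat.add_succ_sub_one] at this
    linarith
  have hratio : t 1 / t (n + 2) ≤ D * (t 1 / t (n + 3)) := by
    have := hg.succ_le (n + 2) (by omega) (by omega)
    rw [mul_div_assoc', div_le_div_iff₀ ha hb]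
    nlinarith
  have hexp : (0 : ℝ) ≤ (3 - α) / r := div_nonneg (by linarith) (by linarith)
  have e1 : (t (n + 3) - t (n + 2)) ^ (3 - α) ≤ D ^ (3 - α) * (t (n + 2) ^ (3 - α) *
      (D ^ ((3 - α) / r) * (t 1 / t (n + 3)) ^ ((3 - α) / r))) := by
    calc (t (n + 3) - t (n + 2)) ^ (3 - α)
        ≤ (D * (t (n + 2) * (t 1 / t (n + 2)) ^ (1 / r))) ^ (3 - α) :=
          rpow_le_rpow (by linarith) hstep (by linarith)
      _ = D ^ (3 - α) * (t (n + 2) ^ (3 - α) * (t 1 / t (n + 2)) ^ ((3 - α) / r)) := by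
          rw [mul_rpow hD0.le (by positivity), mul_rpow ha.le (by positivity), ← rpow_mul hy.le,
            one_div_mul_eq_div]
      _ ≤ _ := by
          rw [← mul_rpow hD0.le (by positivity)]
          gcongr
  have e2 : t (n + 2) ^ (α - 3) * t (n + 2) ^ (3 - α) = 1 := by
    rw [← rpow_add ha]; simp
  calc 2 / (1 - α) * (S * t (n + 2) ^ (α - 3) * (t (n + 3) - t (n + 2)) ^ (3 - α))
      ≤ 2 / (1 - α) * (S * t (n + 2) ^ (α - 3) * (D ^ (3 - α) * (t (n + 2) ^ (3 - α) *
      (D ^ ((3 - α) / r) * (t 1 / t (n + 3)) ^ ((3 - α) / r))))) := by gcongr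
    _ = 2 / (1 - α) * S * D ^ (3 - α) * D ^ ((3 - α) / r) * (t 1 / t (n + 3)) ^ ((3 - α) / r) *
        (t (n + 2) ^ (α - 3) * t (n + 2) ^ (3 - α)) := by ring
    _ = _ := by rw [e2]; ring

theorem GradedRegularity.abs_error_level_two_le {α S D r : ℝ} {M : ℕ} {t : ℕ → ℝ} {u : ℝ → ℝ}
    (h : GradedRegularity α S M t u 2) (hg : LocallyGraded D r M t) (hM : 2 ≤ M)
    (hα0 : 0 < α) (hα1 : α < 1) (hD : 1 ≤ D) (hS : 0 ≤ S) :
    |∫ s in (t 1)..(tStar α t 2), (tStar α t 2 - s) ^ (-α) *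
        ((u (t 2) - u (t 1)) / (t 2 - t 1) - deriv u s)| ≤ (D + 1) * D / (1 - α) * S := by
  have hD0 : 0 < D := by linarith
  have hα' : 0 < 1 - α := by linarith
  have h1 := hg.pos (j := 1) le_rfl (by omega)
  have h12 : t 1 < t 2 := hg.lt_succ 1 (by omega)
  have h2 : 0 < t 2 := h1.trans h12
  have hτ : t 2 ≤ D * (t 2 - t 1) := by simpa [hg.zero] using hg.two_step_le 1 le_rfl (by omega)
  have hsucc : t 2 ≤ D * t 1 := hg.succ_le 1 le_rfl (by omega)
  have hps : tStar α t 2 = t 2 - α / 2 * (t 2 - t 1) := rfl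
  have hp1 : t 1 < tStar α t 2 := by rw [hps]; nlinarith
  have hp2 : tStar α t 2 < t 2 := by rw [hps]; nlinarith
  have hslope : |(u (t 2) - u (t 1)) / (t 2 - t 1)| ≤ D * S * t 1 ^ (α - 1) := by
    have e : t 2 ^ α = t 2 ^ (α - 1) * t 2 := by
      rw [rpow_sub h2, rpow_one, div_mul_cancel₀ _ h2.ne']
    have hle : t 2 ^ (α - 1) ≤ t 1 ^ (α - 1) := rpow_le_rpow_of_nonpos h1 h12.le (by linarith)
    rw [abs_div, abs_of_pos (sub_pos.2 h12), div_le_iff₀ (sub_pos.2 h12)]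
    calc |u (t 2) - u (t 1)| ≤ S * t 2 ^ α := h.osc_le _ ⟨h2.le, le_rfl⟩ _ ⟨h1.le, h12.le⟩
      _ = S * t 2 ^ (α - 1) * t 2 := by rw [e]; ring
      _ ≤ S * t 1 ^ (α - 1) * (D * (t 2 - t 1)) := by gcongr
      _ = _ := by ring
  refine (abs_integral_const_sub_le (G := (D + 1) * S * t 1 ^ (α - 1)) hα1 hp1.le
    fun s hs => ?_).trans ?_
  · have hd := h.deriv_le s ⟨h1.trans hs.1, hs.2.trans hp2⟩
    have hle : s ^ (α - 1) ≤ t 1 ^ (α - 1) := rpow_le_rpow_of_nonpos h1 hs.1.le (by linarith)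
    calc _ ≤ _ := abs_sub _ _
      _ ≤ D * S * t 1 ^ (α - 1) + S * t 1 ^ (α - 1) :=
          add_le_add hslope (hd.trans (mul_le_mul_of_nonneg_left hle hS))
      _ = _ := by ring
  · have hpow : (tStar α t 2 - t 1) ^ (1 - α) ≤ D * t 1 ^ (1 - α) :=
      rpow_le_mul_rpow hD h1.le (by linarith) (by linarith) hα'.le (by linarith)
    have e : t 1 ^ (α - 1) * t 1 ^ (1 - α) = 1 := by rw [← rpow_add h1]; simp
    calc _ ≤ (D + 1) * S * t 1 ^ (α - 1) * (D * t 1 ^ (1 - α) / (1 - α)) := by gcongr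
      _ = (D + 1) * D / (1 - α) * S * (t 1 ^ (α - 1) * t 1 ^ (1 - α)) := by ring
      _ = _ := by rw [e, mul_one]

theorem GradedRegularity.abs_error_level_one_le {α S D r : ℝ} {M : ℕ} {t : ℕ → ℝ} {u : ℝ → ℝ}
    (h : GradedRegularity α S M t u 1) (hg : LocallyGraded D r M t) (hM : 2 ≤ M)
    (hα0 : 0 < α) (hα1 : α < 1) (hD : 1 ≤ D) (hS : 0 ≤ S) :
    |∫ s in (t 0)..(tStar α t 1), (tStar α t 1 - s) ^ (-α) *
        ((u (t 1) - u (t 0)) / (t 1 - t 0) - deriv u s)| ≤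
      (D + 1) * (2 ^ α / α + 2 ^ (1 - α) / (1 - α)) * S := by
  have h1 := hg.pos (j := 1) le_rfl (by omega)
  have h12 : t 1 < t 2 := hg.lt_succ 1 (by omega)
  have h2 : 0 < t 2 := h1.trans h12
  have hps : tStar α t 1 = t 1 - α / 2 * t 1 := by simp [tStar, hg.zero]
  have hp0 : 0 < tStar α t 1 := by rw [hps]; nlinarith
  have hp1 : tStar α t 1 < t 1 := by rw [hps]; nlinarith
  have hslope : |(u (t 1) - u 0) / t 1| ≤ D * S * t 1 ^ (α - 1) := by
    have e : t 1 ^ (α - 1) * t 1 = t 1 ^ α := by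
      rw [rpow_sub h1, rpow_one, div_mul_cancel₀ _ h1.ne']
    rw [abs_div, abs_of_pos h1, div_le_iff₀ h1, mul_assoc, e]
    calc |u (t 1) - u 0| ≤ S * t 2 ^ α := h.osc_le _ ⟨h1.le, h12.le⟩ _ ⟨le_rfl, h2.le⟩
      _ ≤ S * (D * t 1 ^ α) := by
          gcongr
          exact rpow_le_mul_rpow hD h1.le h2.le (hg.succ_le 1 le_rfl (by omega)) hα0.le hα1.le
      _ = _ := by ring
  rw [hg.zero, sub_zero, mul_right_comm, ← integral_weight_majorant hα0 hα1 hp0,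
    ← intervalIntegral.integral_const_mul, ← Real.norm_eq_abs]
  refine intervalIntegral.norm_integral_le_of_norm_le hp0.le (ae_of_all _ fun s hs => ?_)
    ((intervalIntegrable_weight_majorant hα0 hα1 _).const_mul _)
  have hd := h.deriv_le s ⟨hs.1, hs.2.trans_lt (hp1.trans h12)⟩
  have hle : t 1 ^ (α - 1) ≤ s ^ (α - 1) :=
    rpow_le_rpow_of_nonpos hs.1 (hs.2.trans hp1.le) (by linarith)
  have hw : 0 ≤ (tStar α t 1 - s) ^ (-α) := rpow_nonneg (by linarith [hs.2]) _
  have hD0 : 0 < D := by linarith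
  have hsum : |(u (t 1) - u 0) / t 1 - deriv u s| ≤ (D + 1) * S * s ^ (α - 1) := by
    calc _ ≤ _ := abs_sub _ _
      _ ≤ D * S * s ^ (α - 1) + S * s ^ (α - 1) :=
          add_le_add (hslope.trans (mul_le_mul_of_nonneg_left hle (by positivity))) hd
      _ = _ := by ring
  rw [Real.norm_eq_abs, abs_mul, abs_of_nonneg hw]
  calc _ ≤ (tStar α t 1 - s) ^ (-α) * ((D + 1) * S * s ^ (α - 1)) := by gcongr
    _ = (D + 1) * S * ((tStar α t 1 - s) ^ (-α) * s ^ (α - 1)) := by ring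
    _ ≤ _ := mul_le_mul_of_nonneg_left (weight_mul_rpow_le hα0 hα1 hs.1 hs.2) (by positivity)

theorem GradedRegularity.deltaAlik_sub_caputo {α S D r : ℝ} {M m n : ℕ} {t : ℕ → ℝ} {u : ℝ → ℝ}
    (h : GradedRegularity α S M t u m) (hg : LocallyGraded D r M t) (hM : 2 ≤ M) (hnM : n + 1 ≤ M)
    (hα0 : 0 < α) (hα1 : α < 1) :
    deltaAlik α t (fun j => u (t j)) (n + 1) - caputo α u (tStar α t (n + 1)) =
      1 / Real.Gamma (1 - α) *
        ((∑ i ∈ Finset.range n, ∫ s in (t i)..(t (i + 1)), (tStar α t (n + 1) - s) ^ (-α) *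
          (deriv (fun x => lagQuad (t i) (t (i + 1)) (t (i + 2)) (u (t i)) (u (t (i + 1)))
            (u (t (i + 2))) x) s - deriv u s)) +
        ∫ s in (t n)..(tStar α t (n + 1)), (tStar α t (n + 1) - s) ^ (-α) *
          ((u (t (n + 1)) - u (t n)) / (t (n + 1) - t n) - deriv u s)) := by
  have hlt := hg.lt_succ n (by omega)
  have hps : tStar α t (n + 1) = t (n + 1) - α / 2 * (t (n + 1) - t n) := rfl
  have hpn : t n < tStar α t (n + 1) := by rw [hps]; nlinarith
  have hpn' : tStar α t (n + 1) < t (n + 1) := by rw [hps]; nlinarith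
  have hle := hg.le hnM le_rfl
  set p := tStar α t (n + 1) with hp
  set w : ℝ → ℝ := fun s => (p - s) ^ (-α) with hw
  have hwc : ∀ i, i < n → ContinuousOn w (uIcc (t i) (t (i + 1))) := fun i hi => by
    rw [uIcc_of_le (hg.lt_succ i (by omega)).le]
    exact continuousOn_sub_rpow ((hg.le hi (by omega)).trans_lt hpn) _
  have hi1 : ∀ i, i < n → IntervalIntegrable (fun s => w s * deriv u s) volume (t i) (t (i + 1)) :=
    fun i hi => (h.intervalIntegrable_deriv hg hM hα0 (by omega)).continuousOn_mul (hwc i hi)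
  have hi2 : IntervalIntegrable (fun s => w s * deriv u s) volume (t n) p := by
    rcases Nat.eq_zero_or_pos n with rfl | hn
    · rw [hg.zero]
      rw [hg.zero] at hpn
      refine IntervalIntegrable.mono_fun'
        ((intervalIntegrable_weight_majorant hα0 hα1 p).const_mul S)
        ((by fun_prop : Measurable w).mul (measurable_deriv u)).aestronglyMeasurable ?_
      refine (ae_restrict_iff' measurableSet_uIoc).2 (ae_of_all _ fun s hs => ?_)
      rw [uIoc_of_le hpn.le] at hs
      have h12 := hg.lt_succ 1 (by omega)
      have hd := h.deriv_le s ⟨hs.1, hs.2.trans_lt (hpn'.trans h12)⟩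
      have hw0 : 0 ≤ w s := rpow_nonneg (by linarith [hs.2]) _
      have hs0 : 0 < s ^ (α - 1) := rpow_pos_of_pos hs.1 _
      have hS : 0 ≤ S := nonneg_of_mul_nonneg_left ((abs_nonneg _).trans hd) hs0
      change ‖w s * deriv u s‖ ≤ _
      rw [Real.norm_eq_abs, abs_mul, abs_of_nonneg hw0]
      calc w s * |deriv u s| ≤ w s * (S * s ^ (α - 1)) := by gcongr
        _ = S * (w s * s ^ (α - 1)) := by ring
        _ ≤ _ := mul_le_mul_of_nonneg_left (weight_mul_rpow_le hα0 hα1 hs.1 hs.2) hS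
    · refine (intervalIntegrable_sub_rpow_neg hα1 (t n) p).mul_continuousOn
        (h.continuousOn_deriv.mono fun s hs => ?_)
      rw [uIcc_of_le hpn.le] at hs
      exact ⟨(hg.pos hn (by omega)).trans_le hs.1, (hs.2.trans_lt hpn').trans_le hle⟩
  have hcap : ∫ s in (0 : ℝ)..p, w s * deriv u s =
      (∑ i ∈ Finset.range n, ∫ s in (t i)..(t (i + 1)), w s * deriv u s) +
        ∫ s in (t n)..p, w s * deriv u s := by
    rw [intervalIntegral.sum_integral_adjacent_intervals hi1, hg.zero.symm,
      intervalIntegral.integral_add_adjacent_intervals (IntervalIntegrable.trans_iterate hi1) hi2]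
  have hsum : ∀ (k : ℕ) (f : ℕ → ℝ),
      ∑ j ∈ Finset.Icc 1 k, f j = ∑ i ∈ Finset.range k, f (i + 1) := fun k f => by
    rw [← Finset.Ico_add_one_right_eq_Icc, Finset.sum_Ico_eq_sum_range]
    simp [add_comm]
  have hquad : ∀ i ∈ Finset.range n, ∫ s in (t i)..(t (i + 1)), w s *
      (deriv (fun x => lagQuad (t i) (t (i + 1)) (t (i + 2)) (u (t i)) (u (t (i + 1)))
        (u (t (i + 2))) x) s - deriv u s) =
      (∫ s in (t i)..(t (i + 1)), w s * deriv (fun x => lagQuad (t i) (t (i + 1)) (t (i + 2))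
        (u (t i)) (u (t (i + 1))) (u (t (i + 2))) x) s) -
      ∫ s in (t i)..(t (i + 1)), w s * deriv u s := by
    intro i hi
    have hi' := Finset.mem_range.1 hi
    rw [← intervalIntegral.integral_sub _ (hi1 i hi')]
    · simp only [mul_sub]
    · exact ((hwc i hi').mul ((contDiff_lagQuad _ _ _ _ _ _).continuous_deriv
        le_rfl).continuousOn).intervalIntegrable
  have hlin : ∫ s in (t n)..p, w s * ((u (t (n + 1)) - u (t n)) / (t (n + 1) - t n) - deriv u s) =
      (∫ s in (t n)..p, w s * ((u (t (n + 1)) - u (t n)) / (t (n + 1) - t n))) -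
      ∫ s in (t n)..p, w s * deriv u s := by
    rw [← intervalIntegral.integral_sub
      ((intervalIntegrable_sub_rpow_neg hα1 (t n) p).mul_const _) hi2]
    simp only [hw, mul_sub]
  rw [deltaAlik, caputo, ← mul_sub, add_tsub_cancel_right, hsum]
  simp only [add_tsub_cancel_right, ← hp]
  rw [hcap, Finset.sum_congr rfl hquad, Finset.sum_sub_distrib, hlin]
  ring

theorem le_mul_rpow_neg_of_rpow_mul_le {x q y S : ℝ} (hx : 0 < x) (h : x ^ q * y ≤ S) :
    y ≤ S * x ^ (-q) := by
  rw [rpow_neg hx.le, ← div_eq_mul_inv, le_div_iff₀ (rpow_pos_of_pos hx q), mul_comm]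
  exact h

theorem abs_sub_le_csSup_sub_csInf_image {u : ℝ → ℝ} {a b x y : ℝ} (hu : ContinuousOn u (Icc a b))
    (hx : x ∈ Icc a b) (hy : y ∈ Icc a b) :
    |u x - u y| ≤ sSup (u '' Icc a b) - sInf (u '' Icc a b) := by
  have hc := isCompact_Icc.image_of_continuousOn hu
  have h1 := le_csSup hc.bddAbove (mem_image_of_mem u hx)
  have h2 := le_csSup hc.bddAbove (mem_image_of_mem u hy)
  have h3 := csInf_le hc.bddBelow (mem_image_of_mem u hx)
  have h4 := csInf_le hc.bddBelow (mem_image_of_mem u hy)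
  rw [abs_le]; constructor <;> linarith

theorem gradedRegularity_of_psiAlik_le {α S D r : ℝ} {M m : ℕ} {t : ℕ → ℝ} {u : ℝ → ℝ}
    (hg : LocallyGraded D r M t) (hM : 2 ≤ M) (hm : 1 ≤ m) (hmM : m ≤ M)
    (hc : ContinuousOn u (Icc 0 (t M))) (hd : ContDiffOn ℝ 3 u (Ioc 0 (t M)))
    (hb : BddAbove ((fun s => s ^ (1 - α) * |deriv u s|) '' Ioo 0 (t 2)))
    (hb3 : ∀ j : ℕ, 2 ≤ j → j ≤ M - 1 →
      BddAbove ((fun s => |deriv (deriv (deriv u)) s|) '' Ioo (t (j - 1)) (t (j + 1))))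
    (hS : ∀ j ∈ Finset.Icc 1 m, psiAlik α M t u j ≤ S) :
    0 ≤ S ∧ GradedRegularity α S M t u m := by
  have h2 := hg.pos (j := 2) (by omega) hM
  have hc2 := hc.mono (Icc_subset_Icc le_rfl (hg.le hM le_rfl))
  have hS1 := hS 1 (Finset.mem_Icc.2 ⟨le_rfl, hm⟩)
  rw [psiAlik, if_pos rfl] at hS1
  have hsup : 0 ≤ sSup ((fun s => s ^ (1 - α) * |deriv u s|) '' Ioo 0 (t 2)) := by
    refine Real.sSup_nonneg ?_
    rintro _ ⟨s, hs, rfl⟩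
    exact mul_nonneg (rpow_nonneg hs.1.le _) (abs_nonneg _)
  have hosc : 0 ≤ t 2 ^ (-α) * (sSup (u '' Icc 0 (t 2)) - sInf (u '' Icc 0 (t 2))) :=
    mul_nonneg (rpow_nonneg h2.le _) ((abs_nonneg _).trans
      (abs_sub_le_csSup_sub_csInf_image hc2 (left_mem_Icc.2 h2.le) (left_mem_Icc.2 h2.le)))
  have hu : ContDiffOn ℝ 3 u (Ioo 0 (t M)) := hd.mono Ioo_subset_Ioc_self
  have hu1 : ContDiffOn ℝ 2 (deriv u) (Ioo 0 (t M)) := hu.deriv_of_isOpen isOpen_Ioo (by norm_num)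
  have hu2 : ContDiffOn ℝ 1 (deriv (deriv u)) (Ioo 0 (t M)) :=
    hu1.deriv_of_isOpen isOpen_Ioo (by norm_num)
  refine ⟨by linarith, hc, fun x hx => ?_, fun x hx => ?_, fun x hx => ?_, fun s hs => ?_,
    fun x hx y hy => ?_, fun j hj hjm s hs => ?_⟩
  · exact (hu.differentiableOn (by norm_num)).differentiableAt (isOpen_Ioo.mem_nhds hx)
  · exact (hu1.differentiableOn (by norm_num)).differentiableAt (isOpen_Ioo.mem_nhds hx)
  · exact (hu2.differentiableOn (by norm_num)).differentiableAt (isOpen_Ioo.mem_nhds hx)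
  · rw [← neg_sub 1 α]
    refine le_mul_rpow_neg_of_rpow_mul_le hs.1 ?_
    have := le_csSup hb (mem_image_of_mem (fun s => s ^ (1 - α) * |deriv u s|) hs)
    linarith
  · have := le_mul_rpow_neg_of_rpow_mul_le h2 (by linarith : t 2 ^ (-α) *
      (sSup (u '' Icc 0 (t 2)) - sInf (u '' Icc 0 (t 2))) ≤ S)
    rw [neg_neg] at this
    exact (abs_sub_le_csSup_sub_csInf_image hc2 hx hy).trans this
  · have hSj := hS j (Finset.mem_Icc.2 ⟨by omega, hjm.le⟩)
    rw [psiAlik, if_neg (by omega), if_neg (by omega)] at hSj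
    have hj0 := hg.pos (j := j) (by omega) (by omega)
    rw [← neg_sub 3 α]
    refine le_mul_rpow_neg_of_rpow_mul_le hj0 (le_trans ?_ hSj)
    exact mul_le_mul_of_nonneg_left (le_csSup (hb3 j hj (by omega))
      (mem_image_of_mem (fun s => |deriv (deriv (deriv u)) s|) hs)) (rpow_nonneg hj0.le _)

/-- The truncation error is bounded in terms of the local regularity constant. -/
theorem GradedRegularity.abs_truncation_error_le {α r D : ℝ} (hα0 : 0 < α) (hα1 : α < 1)
    (hr1 : 1 ≤ r) (hD : 1 ≤ D) :
    ∃ C : ℝ, 0 < C ∧ ∀ (S : ℝ) (M m : ℕ) (t : ℕ → ℝ) (u : ℝ → ℝ),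
      GradedRegularity α S M t u m → LocallyGraded D r M t → 2 ≤ M → 1 ≤ m → m ≤ M → 0 ≤ S →
      |deltaAlik α t (fun j => u (t j)) m - caputo α u (tStar α t m)| ≤
        C * (S * (t 1 / t m) ^ min (α + 1) ((3 - α) / r)) := by
  obtain ⟨Cm, hCm, hmid⟩ := GradedRegularity.abs_sum_interior_error_le hα0 hα1 hr1 hD
  have hΓ : 0 < Real.Gamma (1 - α) := Real.Gamma_pos_of_pos (by linarith)
  have hD0 : 0 < D := by linarith
  have hα' : 0 < 1 - α := by linarith
  set β := min (α + 1) ((3 - α) / r) with hβ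
  set Cf := α * (2 + 2 * D) * D * (2 * D) ^ (α + 1) with hCf
  set Cl := 2 / (1 - α) * D ^ (3 - α) * D ^ ((3 - α) / r) with hCl
  set C2 := (D + 1) * D / (1 - α) * D ^ 2 with hC2
  set C1 := (D + 1) * (2 ^ α / α + 2 ^ (1 - α) / (1 - α)) with hC1
  have hCf0 : 0 < Cf := by positivity
  have hCl0 : 0 < Cl := by positivity
  have hC20 : 0 < C2 := by positivity
  have hC10 : 0 < C1 := by positivity
  refine ⟨1 / Real.Gamma (1 - α) * (Cm + Cf + Cl + C2 + C1), by positivity, ?_⟩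
  intro S M m t u h hg hM hm hmM hS
  obtain ⟨n, rfl⟩ : ∃ n, m = n + 1 := ⟨m - 1, by omega⟩
  rw [h.deltaAlik_sub_caputo hg hM hmM hα0 hα1, abs_mul, abs_of_pos (by positivity), mul_assoc]
  refine mul_le_mul_of_nonneg_left ?_ (by positivity)
  have h1 := hg.pos (j := 1) le_rfl (by omega)
  have hz := hg.pos hm hmM
  have hy : 0 < t 1 / t (n + 1) := by positivity
  have hy1 : t 1 / t (n + 1) ≤ 1 := (div_le_one hz).2 (hg.le hm hmM)
  set R := S * (t 1 / t (n + 1)) ^ β with hR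
  have hR0 : 0 ≤ R := by positivity
  have hexp : ∀ q, β ≤ q → S * (t 1 / t (n + 1)) ^ q ≤ R := fun q hq =>
    mul_le_mul_of_nonneg_left (rpow_le_rpow_of_exponent_ge hy hy1 hq) hS
  have hps : tStar α t (n + 1) = t (n + 1) - α / 2 * (t (n + 1) - t n) := rfl
  have hlt := hg.lt_succ n (by omega)
  have hpz : tStar α t (n + 1) ≤ t (n + 1) := by rw [hps]; nlinarith
  have hpm : t (n + 1) + t n ≤ 2 * tStar α t (n + 1) := by rw [hps]; nlinarith
  rcases n with _ | n
  · have := h.abs_error_level_one_le hg hM hα0 hα1 hD hS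
    rw [Finset.sum_range_zero, zero_add]
    have hRS : R = S := by rw [hR, zero_add, div_self h1.ne', one_rpow, mul_one]
    rw [hRS]
    refine this.trans (mul_le_mul_of_nonneg_right ?_ hS)
    linarith
  · have hfirst := (h.abs_first_error_le hg hmM hα0 hα1 hD hS hpm).trans
      (mul_le_mul_of_nonneg_left (hexp (α + 1) (min_le_left _ _)) hCf0.le)
    have hmiddle := hmid S _ M n t u h hg hmM hS hpm hpz
    have hlast : |∫ s in (t (n + 1))..(tStar α t (n + 2)), (tStar α t (n + 2) - s) ^ (-α) *
        ((u (t (n + 2)) - u (t (n + 1))) / (t (n + 2) - t (n + 1)) - deriv u s)| ≤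
        (Cl + C2) * R := by
      rcases n with _ | n
      · refine (h.abs_error_level_two_le hg hM hα0 hα1 hD hS).trans ?_
        have hinv : 1 ≤ D * (t 1 / t 2) := by
          rw [mul_div_assoc', le_div_iff₀ hz, one_mul]
          exact hg.succ_le 1 le_rfl (by omega)
        have hR2 : S ≤ D ^ 2 * R := by
          have h2 := hexp 2 ((min_le_left _ _).trans (by linarith))
          rw [rpow_two] at h2
          calc S = S * 1 := (mul_one S).symm
            _ ≤ S * (D * (t 1 / t 2)) ^ 2 := by
                gcongr
                exact one_le_pow₀ hinv
            _ = D ^ 2 * (S * (t 1 / t 2) ^ 2) := by ring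
            _ ≤ _ := by gcongr
        calc (D + 1) * D / (1 - α) * S ≤ (D + 1) * D / (1 - α) * (D ^ 2 * R) := by gcongr
          _ = C2 * R := by rw [hC2]; ring
          _ ≤ _ := by gcongr; linarith
      · refine (h.abs_last_error_le hg hmM hα0 hα1 hr1 hD hS).trans
          ((mul_le_mul_of_nonneg_left (hexp _ (min_le_right _ _)) hCl0.le).trans ?_)
        gcongr
        linarith
    rw [Finset.sum_range_succ']
    refine (abs_add_le _ _).trans ?_
    refine (add_le_add (abs_add_le _ _) le_rfl).trans ?_
    refine (add_le_add (add_le_add hmiddle hfirst) hlast).trans ?_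
    have := mul_nonneg hC10.le hR0
    nlinarith

/-- Truncation-error bound for the Alikhanov operator on quasi-graded meshes
(Lemma 4.7). -/
theorem stmt18 (α r T c0 C0 : ℝ)
    (hα0 : 0 < α) (hα1 : α < 1) (hr1 : 1 ≤ r)
    (hT : 0 < T) (hc0 : 0 < c0) (hcC : c0 ≤ C0) :
    ∃ C : ℝ, 0 < C ∧
      ∀ (M : ℕ) (t : ℕ → ℝ), IsMesh T M t → QuasiGraded r c0 C0 M t →
        ∀ u : ℝ → ℝ, ContinuousOn u (Set.Icc 0 T) → ContDiffOn ℝ 3 u (Set.Ioc 0 T) →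
          BddAbove ((fun s => s ^ (1 - α) * |deriv u s|) '' Set.Ioo 0 (t 2)) →
          (∀ j : ℕ, 2 ≤ j → j ≤ M - 1 →
            BddAbove ((fun s => |deriv (deriv (deriv u)) s|) ''
              Set.Ioo (t (j - 1)) (t (j + 1)))) →
          ∀ (m : ℕ) (hm : 1 ≤ m), m ≤ M →
            |deltaAlik α t (fun j => u (t j)) m - caputo α u (tStar α t m)| ≤
              C * (t 1 / t m) ^ min (α + 1) ((3 - α) / r) *
                (Finset.Icc 1 m).sup' (Finset.nonempty_Icc.mpr hm) (psiAlik α M t u) := by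
  obtain ⟨D, hD, hgraded⟩ := QuasiGraded.exists_locallyGraded hr1 hc0 hcC
  obtain ⟨C, hC, herr⟩ := GradedRegularity.abs_truncation_error_le hα0 hα1 hr1 hD
  refine ⟨C, hC, ?_⟩
  intro M t hmesh hq u hcont hdiff hb hb3 m hm hmM
  have hg := hgraded T M t hmesh hq
  obtain ⟨hM, -, -, rfl⟩ := hmesh
  obtain ⟨hS, hreg⟩ := gradedRegularity_of_psiAlik_le
    (S := (Finset.Icc 1 m).sup' (Finset.nonempty_Icc.mpr hm) (psiAlik α M t u)) hg hM hm hmM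
    hcont hdiff hb hb3 fun _ hj => Finset.le_sup' (psiAlik α M t u) hj
  refine (herr _ M m t u hreg hg hM hm hmM hS).trans_eq ?_
  ring
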